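/- arXiv:2308.01706 — 2 statements merged into one kernel-verified Lean document; each statement's English description precedes it below -/
import Mathlib

section
/- Main theorem (genericity of unbounded distortion): let Γ_{λ,er} be the set of lifts F of C¹ expanding circle maps (of any degree m ≥ 2) whose induced circle map f_F preserves Lebesgue measure and is ergodic with respect to it. Then the set { F ∈ Γ_{λ,er} : F has unbounded distortion } is residual (comeagre) in Γ_{λ,er} equipped with the C¹ topology. -/
open Set MeasureTheory

/-- `F` is a lift of a C¹ expanding circle map of degree `m ≥ 2`. -/
def IsLiftDeg (m : ℤ) (F : ℝ → ℝ) : Prop :=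
  2 ≤ m ∧ ContDiff ℝ 1 F ∧ (∀ x : ℝ, F (x + 1) = F x + m) ∧ ∀ x : ℝ, 1 < deriv F x

/-- The circle map induced by the lift `F` preserves the Haar (Lebesgue)
probability measure on `ℝ/ℤ`. -/
def CirclePreserves (F : ℝ → ℝ) : Prop :=
  ∀ φ : AddCircle (1 : ℝ) → AddCircle (1 : ℝ),
    (∀ x : ℝ, φ x = ((F x : ℝ) : AddCircle (1 : ℝ))) →
    ∀ A : Set (AddCircle (1 : ℝ)), MeasurableSet A → volume (φ ⁻¹' A) = volume A

/-- The circle map induced by the lift `F` is ergodic for the Haar (Lebesgue)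
probability measure on `ℝ/ℤ`. -/
def CircleErgodic (F : ℝ → ℝ) : Prop :=
  ∀ φ : AddCircle (1 : ℝ) → AddCircle (1 : ℝ),
    (∀ x : ℝ, φ x = ((F x : ℝ) : AddCircle (1 : ℝ))) →
    ∀ A : Set (AddCircle (1 : ℝ)), MeasurableSet A → φ ⁻¹' A = A →
      volume A = 0 ∨ volume A = 1

/-- The pair `p = (φ, ψ)` of continuous functions on `[0,1]` represents the map
`F : ℝ → ℝ`: `φ = F|_{[0,1]}` and `ψ = F'|_{[0,1]}`.  This is the injection
giving the C¹ topology. -/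
def RepresentsPair (p : C(Set.Icc (0 : ℝ) 1, ℝ) × C(Set.Icc (0 : ℝ) 1, ℝ))
    (F : ℝ → ℝ) : Prop :=
  ∀ x : Set.Icc (0 : ℝ) 1, p.1 x = F x ∧ p.2 x = deriv F x

/-- `Γ_{λ,er}`: (the C¹-embedded copy of) the set of lifts of C¹ expanding
circle maps of some degree `m ≥ 2` whose induced circle map preserves Lebesgue
measure and is ergodic with respect to it. -/
def GammaLamErSet : Set (C(Set.Icc (0 : ℝ) 1, ℝ) × C(Set.Icc (0 : ℝ) 1, ℝ)) :=
  {p | ∃ (F : ℝ → ℝ) (m : ℤ), IsLiftDeg m F ∧ CirclePreserves F ∧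
    CircleErgodic F ∧ RepresentsPair p F}

/-- The lift `F` has unbounded distortion. -/
def UnboundedDistortionLift (F : ℝ → ℝ) : Prop :=
  ∀ M : ℝ, ∃ k : ℕ, 1 ≤ k ∧ ∃ x y : ℝ,
    |F^[k] x - F^[k] y| ≤ 1 ∧
    M < Real.log (deriv (F^[k]) x) - Real.log (deriv (F^[k]) y)

open Filter Topology Function
open scoped NNReal ENNReal

/-- A function on the line whose derivative is bounded below by a positive constant has a global
inverse, which is differentiable. -/
theorem exists_inverse_of_deriv_ge {f f' : ℝ → ℝ} {c : ℝ} (hc : 0 < c)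
    (hf : ∀ x, HasDerivAt f (f' x) x) (hf' : ∀ x, c ≤ f' x) :
    ∃ g : ℝ → ℝ, (∀ x, g (f x) = x) ∧ (∀ y, f (g y) = y) ∧ Continuous g ∧
      ∀ y, HasDerivAt g (f' (g y))⁻¹ y := by
  have hd : Differentiable ℝ f := fun x => (hf x).differentiableAt
  have hder : ∀ x, deriv f x = f' x := fun x => (hf x).deriv
  have hmono : StrictMono f :=
    strictMono_of_deriv_pos fun x => by rw [hder]; exact hc.trans_le (hf' x)
  have hlow := mul_sub_le_image_sub_of_le_deriv hd (C := c) (fun x => by rw [hder]; exact hf' x)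
  have htop : Tendsto f atTop atTop := by
    refine tendsto_atTop_mono' atTop (f₁ := fun x => c * x + f 0) ?_ ?_
    · filter_upwards [eventually_ge_atTop 0] with x hx
      have := hlow hx
      linarith
    · exact tendsto_atTop_add_const_right _ _ (tendsto_id.const_mul_atTop hc)
  have hbot : Tendsto f atBot atBot := by
    refine tendsto_atBot_mono' atBot (f₁ := fun x => c * x + f 0) ?_ ?_
    · filter_upwards [eventually_le_atBot 0] with x hx
      have := hlow hx
      linarith
    · exact tendsto_atBot_add_const_right _ _ (tendsto_id.const_mul_atBot hc)
  have hsurj : Surjective f := hd.continuous.surjective htop hbot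
  let e := hmono.orderIsoOfSurjective f hsurj
  have hl : ∀ x, e.symm (f x) = x := fun x => e.symm_apply_apply x
  have hr : ∀ y, f (e.symm y) = y := fun y => e.apply_symm_apply y
  refine ⟨e.symm, hl, hr, e.symm.continuous, fun y => ?_⟩
  exact HasDerivAt.of_local_left_inverse e.symm.continuous.continuousAt (hf _)
    (hc.trans_le (hf' _)).ne' (Eventually.of_forall hr)

theorem sub_eq_of_hasDerivAt_one {S : ℝ → ℝ} (hS : ∀ x, HasDerivAt S 1 x) (a b : ℝ) :
    S b - S a = b - a := by
  have := is_const_of_deriv_eq_zero (f := fun x => S x - x)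
    (fun x => ((hS x).sub (hasDerivAt_id x)).differentiableAt)
    (fun x => by simpa using ((hS x).fun_sub (hasDerivAt_id' x)).deriv) a b
  linarith

/-- `F` is a lift of a `C¹` expanding circle map of degree `m ≥ 2`, `g` is the inverse of `F`, and
`h` is the derivative of `g`. -/
structure LiftPair (m : ℕ) (F g h : ℝ → ℝ) : Prop where
  two_le : 2 ≤ m
  left : ∀ x, g (F x) = x
  right : ∀ y, F (g y) = y
  hasDerivAt : ∀ y, HasDerivAt g (h y) y
  cont : Continuous h
  pos : ∀ y, 0 < h y
  lt_one : ∀ y, h y < 1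
  shift : ∀ y, g (y + m) = g y + 1

theorem IsLiftDeg.exists_liftPair {m : ℤ} {F : ℝ → ℝ} (hF : IsLiftDeg m F) :
    ∃ (n : ℕ) (g h : ℝ → ℝ), (n : ℤ) = m ∧ LiftPair n F g h := by
  obtain ⟨hm, hC, hper, hexp⟩ := hF
  obtain ⟨n, rfl⟩ := Int.eq_ofNat_of_zero_le (by lia : 0 ≤ m)
  have hd : ∀ x, HasDerivAt F (deriv F x) x :=
    fun x => (hC.differentiable (by norm_num) x).hasDerivAt
  obtain ⟨g, hl, hr, hgc, hgd⟩ := exists_inverse_of_deriv_ge one_pos hd (fun x => (hexp x).le)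
  have hdc : Continuous (deriv F) := hC.continuous_deriv le_rfl
  refine ⟨n, g, fun y => (deriv F (g y))⁻¹, rfl,
    ⟨by exact_mod_cast hm, hl, hr, hgd, ?_, ?_, ?_, ?_⟩⟩
  · exact (hdc.comp hgc).inv₀ fun y => (one_pos.trans (hexp _)).ne'
  · exact fun y => inv_pos.2 (one_pos.trans (hexp _))
  · exact fun y => inv_lt_one_of_one_lt₀ (hexp _)
  · intro y
    have := hper (g y)
    rw [hr] at this
    rw [← hl (g y + 1), this]
    simp

theorem antiperiod_sum_zero (f : ℝ → ℝ) (m : ℕ) (x : ℝ) :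
    ∑ i ∈ Finset.range m, f (x + 1 + i) - ∑ i ∈ Finset.range m, f (x + i) = f (x + m) - f x := by
  have h := Finset.sum_range_sub (fun i : ℕ => f (x + i)) m
  rw [Finset.sum_sub_distrib] at h
  simp only [Nat.cast_zero, add_zero] at h
  rw [← h]
  congr 1
  refine Finset.sum_congr rfl fun i _ => ?_
  congr 1
  push_cast
  ring

namespace LiftPair

variable {m : ℕ} {F g h : ℝ → ℝ}

theorem differentiable (L : LiftPair m F g h) : Differentiable ℝ g :=
  fun y => (L.hasDerivAt y).differentiableAt

theorem deriv_inv (L : LiftPair m F g h) (y : ℝ) : deriv g y = h y := (L.hasDerivAt y).deriv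

theorem strictMono (L : LiftPair m F g h) : StrictMono g :=
  strictMono_of_deriv_pos fun y => by rw [L.deriv_inv]; exact L.pos y

theorem per (L : LiftPair m F g h) (y : ℝ) : h (y + m) = h y := by
  have h1 : HasDerivAt (fun y => g (y + m)) (h (y + m)) y :=
    (L.hasDerivAt (y + m)).comp_add_const y m
  have h2 : HasDerivAt (fun y => g (y + m)) (h y) y := by
    rw [funext L.shift]
    exact (L.hasDerivAt y).add_const 1
  exact h1.unique h2

theorem map_add_one (L : LiftPair m F g h) (x : ℝ) : F (x + 1) = F x + m := by
  have := L.shift (F x)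
  rw [L.left] at this
  rw [← this, L.right]

theorem map_add_int (L : LiftPair m F g h) (x : ℝ) (j : ℤ) : F (x + j) = F x + m * j := by
  induction j with
  | zero => simp
  | succ i ih =>
    push_cast at ih ⊢
    rw [← add_assoc, L.map_add_one, ih]; ring
  | pred i ih =>
    push_cast at ih ⊢
    have := L.map_add_one (x + (-(i : ℝ) - 1))
    rw [show x + (-(i : ℝ) - 1) + 1 = x + -(i : ℝ) by ring, ih] at this
    linarith

theorem strictMono_fwd (L : LiftPair m F g h) : StrictMono F := fun a b hab => by
  rwa [← L.strictMono.lt_iff_lt, L.left, L.left]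

theorem continuous_fwd (L : LiftPair m F g h) : Continuous F :=
  L.strictMono_fwd.monotone.continuous_of_surjective fun y => ⟨g y, L.right y⟩

theorem hasDerivAt_fwd (L : LiftPair m F g h) (x : ℝ) : HasDerivAt F (h (F x))⁻¹ x :=
  HasDerivAt.of_local_left_inverse L.continuous_fwd.continuousAt (L.hasDerivAt _) (L.pos _).ne'
    (Eventually.of_forall L.left)

theorem isLiftDeg (L : LiftPair m F g h) : IsLiftDeg m F := by
  refine ⟨by exact_mod_cast L.two_le, ?_, by exact_mod_cast L.map_add_one, fun x => ?_⟩
  · rw [contDiff_one_iff_deriv]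
    refine ⟨fun x => (L.hasDerivAt_fwd x).differentiableAt, ?_⟩
    rw [funext fun x => (L.hasDerivAt_fwd x).deriv]
    exact (L.cont.comp L.continuous_fwd).inv₀ fun x => (L.pos _).ne'
  · rw [(L.hasDerivAt_fwd x).deriv]
    exact (one_lt_inv₀ (L.pos _)).2 (L.lt_one _)

theorem isCompact_range (L : LiftPair m F g h) : IsCompact (Set.range h) :=
  Function.Periodic.compact_of_continuous (c := (m : ℝ)) (fun y => L.per y)
    (by have := L.two_le; positivity) L.cont

theorem exists_lower (L : LiftPair m F g h) : ∃ c, 0 < c ∧ c < 1 ∧ ∀ y, c ≤ h y := by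
  obtain ⟨c, ⟨y, rfl⟩, hc⟩ := L.isCompact_range.exists_isLeast (Set.range_nonempty h)
  exact ⟨h y, L.pos y, L.lt_one y, fun z => hc ⟨z, rfl⟩⟩

theorem exists_upper (L : LiftPair m F g h) : ∃ ρ, 0 < ρ ∧ ρ < 1 ∧ ∀ y, h y ≤ ρ := by
  obtain ⟨c, ⟨y, rfl⟩, hc⟩ := L.isCompact_range.exists_isGreatest (Set.range_nonempty h)
  exact ⟨h y, L.pos y, L.lt_one y, fun z => hc ⟨z, rfl⟩⟩

theorem uniformContinuous (L : LiftPair m F g h) : UniformContinuous h := by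
  have : Fact (0 < (m : ℝ)) := ⟨by have := L.two_le; positivity⟩
  have hp : Function.Periodic h (m : ℝ) := L.per
  have hc : Continuous (hp.lift : AddCircle (m : ℝ) → ℝ) := continuous_quot_lift _ L.cont
  have h1 := CompactSpace.uniformContinuous_of_continuous hc
  have h2 : UniformContinuous (QuotientAddGroup.mk' (AddSubgroup.zmultiples (m : ℝ))) :=
    uniformContinuous_of_continuousAt_zero _ (AddCircle.continuous_mk' (m : ℝ)).continuousAt
  exact h1.comp h2

theorem le_abs_sub (L : LiftPair m F g h) {c : ℝ} (hc : ∀ y, c ≤ h y) (x y : ℝ) :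
    c * |x - y| ≤ |g x - g y| := by
  wlog hxy : y ≤ x generalizing x y
  · rw [abs_sub_comm, abs_sub_comm (g x)]
    exact this y x (le_of_not_ge hxy)
  have := mul_sub_le_image_sub_of_le_deriv L.differentiable (C := c)
    (fun x => by rw [L.deriv_inv]; exact hc x) hxy
  rw [abs_of_nonneg (sub_nonneg.2 hxy)]
  exact this.trans (le_abs_self _)

theorem abs_sub_le (L : LiftPair m F g h) {ρ : ℝ} (hρ : ∀ y, h y ≤ ρ) (x y : ℝ) :
    |g x - g y| ≤ ρ * |x - y| := by
  wlog hxy : y ≤ x generalizing x y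
  · rw [abs_sub_comm, abs_sub_comm x]
    exact this y x (le_of_not_ge hxy)
  have := image_sub_le_mul_sub_of_deriv_le L.differentiable (C := ρ)
    (fun x => by rw [L.deriv_inv]; exact hρ x) hxy
  rwa [abs_of_nonneg (sub_nonneg.2 hxy), abs_of_nonneg (sub_nonneg.2 (L.strictMono.monotone hxy))]

end LiftPair

/-- A positive continuous function all of whose fibre sums over `x, x + 1, …, x + m - 1` equal `1`
is the derivative of the inverse of a lift, with a prescribed value at one point. -/
theorem exists_liftPair_of_sum_eq_one {m : ℕ} (hm : 2 ≤ m) {h : ℝ → ℝ} (hc : Continuous h)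
    (hpos : ∀ y, 0 < h y) (hsum : ∀ y, ∑ i ∈ Finset.range m, h (y + i) = 1) (p q : ℝ) :
    ∃ F g, LiftPair m F g h ∧ g q = p := by
  let g : ℝ → ℝ := fun x => p + ∫ t in q..x, h t
  have hg : ∀ y, HasDerivAt g (h y) y := fun y =>
    (intervalIntegral.integral_hasDerivAt_right (hc.intervalIntegrable _ _)
      (hc.stronglyMeasurableAtFilter _ _) hc.continuousAt).const_add p
  have hlt : ∀ y, h y < 1 := by
    intro y
    rw [← hsum y]
    have := Finset.single_lt_sum (f := fun i : ℕ => h (y + i)) (s := Finset.range m) (i := 0)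
      (j := 1) (by norm_num) (by simp; lia) (by simp; lia) (hpos _) (fun k _ _ => (hpos _).le)
    simpa using this
  have hS : ∀ x, HasDerivAt (fun x => ∑ i ∈ Finset.range m, g (x + i)) 1 x := by
    intro x
    rw [← hsum x]
    exact HasDerivAt.fun_sum fun i _ => (hg (x + i)).comp_add_const x i
  have hshift : ∀ y, g (y + m) = g y + 1 := by
    intro y
    have h1 := sub_eq_of_hasDerivAt_one hS y (y + 1)
    have h2 := antiperiod_sum_zero g m y
    linarith
  have hper : Function.Periodic h m := by
    intro y
    have h2 := antiperiod_sum_zero h m y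
    rw [hsum, hsum] at h2
    linarith
  obtain ⟨_, ⟨y, rfl⟩, hcl⟩ := (hper.compact_of_continuous (by positivity) hc).exists_isLeast
    (Set.range_nonempty h)
  obtain ⟨F, h1, h2, -, -⟩ :=
    exists_inverse_of_deriv_ge (hpos y) hg (fun z => hcl ⟨z, rfl⟩)
  exact ⟨F, g, ⟨hm, h2, h1, hg, hc, hpos, hlt, hshift⟩, by simp [g]⟩

theorem volume_addCircle_one {A : Set (AddCircle (1 : ℝ))} (hA : MeasurableSet A) (t : ℝ) :
    volume A = volume ((fun x : ℝ => (x : AddCircle (1 : ℝ))) ⁻¹' A ∩ Set.Ioc t (t + 1)) := by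
  have h := (AddCircle.measurePreserving_mk (1 : ℝ) t).measure_preimage hA.nullMeasurableSet
  rw [← h, Measure.restrict_apply' measurableSet_Ioc]

theorem setLIntegral_Ioc_nat {B : Set ℝ} (hBm : MeasurableSet B) (hB : ∀ x : ℝ, x + 1 ∈ B ↔ x ∈ B)
    {f : ℝ → ℝ≥0∞} (hf : Measurable f) (n : ℕ) :
    ∫⁻ y in B ∩ Set.Ioc 0 (n : ℝ), f y =
      ∫⁻ y in B ∩ Set.Ioc 0 1, ∑ i ∈ Finset.range n, f (y + i) := by
  have hBn : ∀ (n : ℕ) (x : ℝ), x + n ∈ B ↔ x ∈ B := by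
    intro n
    induction n with
    | zero => simp
    | succ n ih => intro x; rw [Nat.cast_succ, ← add_assoc, hB, ih]
  rw [lintegral_finsetSum _ (f := fun i : ℕ => fun y => f (y + i))
    fun i _ => hf.comp (measurable_id.add_const _)]
  induction n with
  | zero => simp
  | succ n ih =>
    rw [Finset.sum_range_succ, ← ih]
    have hsplit : B ∩ Set.Ioc 0 ((n + 1 : ℕ) : ℝ) =
        (B ∩ Set.Ioc 0 (n : ℝ)) ∪ (B ∩ Set.Ioc (n : ℝ) (n + 1)) := by
      rw [← Set.inter_union_distrib_left, Set.Ioc_union_Ioc_eq_Ioc (by positivity) (by simp)]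
      simp
    have hpre : (fun y : ℝ => y + n) ⁻¹' (B ∩ Set.Ioc (n : ℝ) (n + 1)) = B ∩ Set.Ioc 0 1 := by
      ext y
      simp only [Set.mem_preimage, Set.mem_inter_iff, hBn, Set.mem_Ioc]
      constructor <;> rintro ⟨h1, h2, h3⟩ <;> exact ⟨h1, by linarith, by linarith⟩
    have key : ∫⁻ y in B ∩ Set.Ioc 0 1, f (y + n) = ∫⁻ y in B ∩ Set.Ioc (n : ℝ) (n + 1), f y := by
      rw [← hpre]
      exact (measurePreserving_add_right volume (n : ℝ)).setLIntegral_comp_preimage_emb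
        (MeasurableEquiv.addRight (n : ℝ)).measurableEmbedding f _
    rw [hsplit, key, lintegral_union (hBm.inter measurableSet_Ioc)]
    exact (Set.Ioc_disjoint_Ioc_of_le le_rfl).mono Set.inter_subset_right Set.inter_subset_right

namespace LiftPair

variable {m : ℕ} {F g h : ℝ → ℝ}

theorem exists_circleMap (L : LiftPair m F g h) :
    ∃ φ : AddCircle (1 : ℝ) → AddCircle (1 : ℝ),
      ∀ x : ℝ, φ x = ((F x : ℝ) : AddCircle (1 : ℝ)) := by
  have hp : Function.Periodic (fun x => ((F x : ℝ) : AddCircle (1 : ℝ))) 1 := by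
    intro x
    have h1 : ((m : ℝ) : AddCircle (1 : ℝ)) = 0 := by
      rw [AddCircle.coe_eq_zero_iff]
      exact ⟨m, by simp⟩
    simp only [L.map_add_one, AddCircle.coe_add, h1, add_zero]
  exact ⟨hp.lift, fun x => hp.lift_coe x⟩

theorem continuous_circleMap (L : LiftPair m F g h) {φ : AddCircle (1 : ℝ) → AddCircle (1 : ℝ)}
    (hφ : ∀ x : ℝ, φ x = ((F x : ℝ) : AddCircle (1 : ℝ))) : Continuous φ := by
  have hc : Continuous fun x => ((F x : ℝ) : AddCircle (1 : ℝ)) :=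
    (AddCircle.continuous_mk' 1).comp L.continuous_fwd
  exact isQuotientMap_quotient_mk'.continuous_iff.2 (hc.congr fun x => (hφ x).symm)

theorem volume_image (L : LiftPair m F g h) {S : Set ℝ} (hS : MeasurableSet S) :
    volume (g '' S) = ∫⁻ y in S, ENNReal.ofReal (h y) := by
  have := lintegral_image_eq_lintegral_abs_deriv_mul hS
    (fun x _ => (L.hasDerivAt x).hasDerivWithinAt) L.strictMono.injective.injOn 1
  simpa [abs_of_pos (L.pos _)] using this

theorem volume_preimage (L : LiftPair m F g h) {φ : AddCircle (1 : ℝ) → AddCircle (1 : ℝ)}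
    (hφ : ∀ x : ℝ, φ x = ((F x : ℝ) : AddCircle (1 : ℝ))) {A : Set (AddCircle (1 : ℝ))}
    (hA : MeasurableSet A) :
    volume (φ ⁻¹' A) = ∫⁻ y in (fun x : ℝ => (x : AddCircle (1 : ℝ))) ⁻¹' A ∩ Set.Ioc 0 1,
      ENNReal.ofReal (∑ i ∈ Finset.range m, h (y + i)) := by
  set B : Set ℝ := (fun x : ℝ => (x : AddCircle (1 : ℝ))) ⁻¹' A with hB
  have hBm : MeasurableSet B := AddCircle.measurable_mk' hA
  have hB1 : ∀ x : ℝ, x + 1 ∈ B ↔ x ∈ B := by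
    intro x
    simp [hB]
  rw [volume_addCircle_one ((L.continuous_circleMap hφ).measurable hA) (g 0)]
  have himg : (fun x : ℝ => (x : AddCircle (1 : ℝ))) ⁻¹' (φ ⁻¹' A) ∩ Set.Ioc (g 0) (g 0 + 1) =
      g '' (B ∩ Set.Ioc 0 (m : ℝ)) := by
    have h1 : g 0 + 1 = g m := by simpa using (L.shift 0).symm
    rw [h1]
    ext x
    constructor
    · rintro ⟨h1, h2, h3⟩
      refine ⟨F x, ⟨by simpa [hB, hφ] using h1, ?_, ?_⟩, L.left x⟩
      · rwa [← L.strictMono.lt_iff_lt, L.left]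
      · rwa [← L.strictMono.le_iff_le, L.left]
    · rintro ⟨y, ⟨h1, h2, h3⟩, rfl⟩
      exact ⟨by simpa [hφ, L.right, hB] using h1, L.strictMono h2, L.strictMono.monotone h3⟩
  rw [himg, L.volume_image (hBm.inter measurableSet_Ioc),
    setLIntegral_Ioc_nat hBm hB1 (L.cont.measurable.ennreal_ofReal)]
  refine lintegral_congr fun y => ?_
  rw [ENNReal.ofReal_sum_of_nonneg fun i _ => (L.pos _).le]

theorem circlePreserves (L : LiftPair m F g h)
    (hsum : ∀ y, ∑ i ∈ Finset.range m, h (y + i) = 1) : CirclePreserves F := by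
  intro φ hφ A hA
  rw [L.volume_preimage hφ hA, volume_addCircle_one hA 0]
  simp [hsum]

theorem sum_eq_one (L : LiftPair m F g h) (hF : CirclePreserves F) (y : ℝ) :
    ∑ i ∈ Finset.range m, h (y + i) = 1 := by
  obtain ⟨φ, hφ⟩ := L.exists_circleMap
  set H : ℝ → ℝ := fun y => ∑ i ∈ Finset.range m, h (y + i) with hH
  have hHc : Continuous H := continuous_finsetSum _ fun i _ =>
    L.cont.comp (continuous_id.add continuous_const)
  have hHpos : ∀ y, 0 ≤ H y := fun y => Finset.sum_nonneg fun i _ => (L.pos _).le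
  have hper : Function.Periodic H 1 := by
    intro y
    have := antiperiod_sum_zero h m y
    rw [L.per] at this
    simp only [hH]
    linarith
  have hae : (fun y => ENNReal.ofReal (H y)) =ᵐ[volume.restrict (Set.Ioc 0 1)] fun _ => 1 := by
    refine ae_eq_of_forall_setLIntegral_eq_of_sigmaFinite hHc.measurable.ennreal_ofReal
      measurable_const fun S hS _ => ?_
    let e := AddCircle.measurableEquivIoc (1 : ℝ) 0
    set A : Set (AddCircle (1 : ℝ)) := {a | (e a : ℝ) ∈ S} with hAdef
    have hA : MeasurableSet A := (measurable_subtype_coe.comp e.measurable) hS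
    have hAS : (fun x : ℝ => (x : AddCircle (1 : ℝ))) ⁻¹' A ∩ Set.Ioc 0 1 = S ∩ Set.Ioc 0 1 := by
      ext x
      refine and_congr_left fun hx => ?_
      have hx' : x ∈ Set.Ioc (0 : ℝ) (0 + 1) := by simpa using hx
      have : e (x : AddCircle (1 : ℝ)) = ⟨x, hx'⟩ := e.symm.injective (by simp; rfl)
      simp [hAdef, this]
    have h1 := hF φ hφ A hA
    rw [L.volume_preimage hφ hA, volume_addCircle_one hA 0, zero_add, hAS] at h1
    rw [Measure.restrict_restrict hS, h1]
    simp
  have hEq : ∀ y ∈ Set.Icc (0 : ℝ) 1, H y = 1 := by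
    refine Measure.eqOn_Icc_of_ae_eq volume zero_ne_one ?_ hHc.continuousOn continuousOn_const
    rw [restrict_Ioc_eq_restrict_Icc.symm]
    filter_upwards [hae] with y hy
    simpa using hy
  obtain ⟨z, hz, hyz⟩ := hper.exists_mem_Ico₀ one_pos y
  exact hyz.trans (hEq z ⟨hz.1, hz.2.le⟩)

end LiftPair

namespace LiftPair

variable {m : ℕ} {F g h : ℝ → ℝ}

theorem hasDerivAt_iterate (L : LiftPair m F g h) (n : ℕ) (y : ℝ) :
    HasDerivAt g^[n] (∏ i ∈ Finset.range n, h (g^[i] y)) y := by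
  induction n with
  | zero => simpa using hasDerivAt_id y
  | succ n ih =>
    rw [Function.iterate_succ', Finset.prod_range_succ, mul_comm]
    exact (L.hasDerivAt _).comp y ih

theorem abs_iterate_sub_le (L : LiftPair m F g h) {ρ : ℝ} (hρ0 : 0 ≤ ρ) (hρ : ∀ y, h y ≤ ρ) (n : ℕ)
    (x y : ℝ) : |g^[n] x - g^[n] y| ≤ ρ ^ n * |x - y| := by
  induction n with
  | zero => simp
  | succ n ih =>
    rw [Function.iterate_succ_apply', Function.iterate_succ_apply', pow_succ', mul_assoc]
    exact (L.abs_sub_le hρ _ _).trans (mul_le_mul_of_nonneg_left ih hρ0)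

/-- Bounded distortion of the inverse branches when `h` is Lipschitz. -/
theorem exists_prod_iterate_le (L : LiftPair m F g h) {K : ℝ}
    (hK : ∀ x y, |h x - h y| ≤ K * |x - y|) :
    ∃ C, 0 ≤ C ∧ ∀ (n : ℕ) (x y : ℝ), ∏ i ∈ Finset.range n, h (g^[i] x) ≤
      (∏ i ∈ Finset.range n, h (g^[i] y)) * Real.exp (C * |x - y|) := by
  obtain ⟨c, hc0, -, hc⟩ := L.exists_lower
  obtain ⟨ρ, hρ0, hρ1, hρ⟩ := L.exists_upper
  have hK0 : 0 ≤ K := by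
    have := hK 1 0
    simp only [sub_zero, abs_one, mul_one] at this
    exact (abs_nonneg _).trans this
  have h1 : 0 < 1 - ρ := by linarith
  refine ⟨K / c / (1 - ρ), by positivity, fun n => ?_⟩
  set C := K / c / (1 - ρ) with hC
  have hC0 : 0 ≤ C := by positivity
  have hCeq : K / c + C * ρ = C := by
    rw [hC]; field_simp; ring
  induction n with
  | zero =>
    intro x y
    simpa using by positivity
  | succ n ih =>
    intro x y
    simp only [Finset.prod_range_succ', Function.iterate_succ_apply, Function.iterate_zero, id_eq]
    have hx : h x ≤ h y * Real.exp (K / c * |x - y|) := by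
      have h2 := (le_abs_self _).trans (hK x y)
      have h3 := Real.add_one_le_exp (K / c * |x - y|)
      have h4 : K * |x - y| ≤ h y * (K / c * |x - y|) := by
        have : K * |x - y| = c * (K / c * |x - y|) := by field_simp
        rw [this]
        exact mul_le_mul_of_nonneg_right (hc y) (by positivity)
      nlinarith [L.pos y]
    have hg : C * |g x - g y| ≤ C * ρ * |x - y| := by
      rw [mul_assoc]
      exact mul_le_mul_of_nonneg_left (L.abs_sub_le hρ x y) hC0
    calc (∏ i ∈ Finset.range n, h (g^[i] (g x))) * h x
        ≤ ((∏ i ∈ Finset.range n, h (g^[i] (g y))) * Real.exp (C * |g x - g y|)) *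
          (h y * Real.exp (K / c * |x - y|)) :=
          mul_le_mul (ih _ _) hx (L.pos _).le
            (mul_nonneg (Finset.prod_nonneg fun i _ => (L.pos _).le) (Real.exp_nonneg _))
      _ ≤ ((∏ i ∈ Finset.range n, h (g^[i] (g y))) * Real.exp (C * ρ * |x - y|)) *
          (h y * Real.exp (K / c * |x - y|)) := by
          gcongr
          · exact mul_nonneg (L.pos _).le (Real.exp_nonneg _)
          · exact Finset.prod_nonneg fun i _ => (L.pos _).le
      _ = (∏ i ∈ Finset.range n, h (g^[i] (g y))) * h y * Real.exp (C * |x - y|) := by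
          have h5 : C * |x - y| = C * ρ * |x - y| + K / c * |x - y| := by
            rw [← add_mul, add_comm, hCeq]
          rw [h5, Real.exp_add]; ring

theorem volume_iterate_image (L : LiftPair m F g h) (n : ℕ) {S : Set ℝ} (hS : MeasurableSet S) :
    volume (g^[n] '' S) =
      ∫⁻ y in S, ENNReal.ofReal (∏ i ∈ Finset.range n, h (g^[i] y)) := by
  have := lintegral_image_eq_lintegral_abs_deriv_mul hS
    (fun x _ => (L.hasDerivAt_iterate n x).hasDerivWithinAt)
    (L.strictMono.injective.iterate n).injOn 1
  simpa [abs_of_nonneg (Finset.prod_nonneg fun i _ => (L.pos _).le)] using this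

/-- Distortion bounds transfer the relative size of a subset of a unit interval to its image. -/
theorem le_volume_image (L : LiftPair m F g h) {C : ℝ} (hC0 : 0 ≤ C)
    (hC : ∀ (n : ℕ) (x y : ℝ), ∏ i ∈ Finset.range n, h (g^[i] x) ≤
      (∏ i ∈ Finset.range n, h (g^[i] y)) * Real.exp (C * |x - y|)) (n : ℕ) (y : ℝ) {S : Set ℝ}
    (hS : MeasurableSet S) (hSy : S ⊆ Metric.closedBall y (1 / 2)) :
    ENNReal.ofReal (Real.exp (-C)) * volume S * volume (g^[n] '' Metric.closedBall y (1 / 2)) ≤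
      volume (g^[n] '' S) := by
  set P := ∏ i ∈ Finset.range n, h (g^[i] y)
  have hP : 0 ≤ P := Finset.prod_nonneg fun i _ => (L.pos _).le
  have hup : volume (g^[n] '' Metric.closedBall y (1 / 2)) ≤
      ENNReal.ofReal (P * Real.exp (C / 2)) := by
    rw [L.volume_iterate_image n measurableSet_closedBall]
    refine (setLIntegral_mono (g := fun _ => ENNReal.ofReal (P * Real.exp (C / 2)))
      measurable_const fun x hx => ENNReal.ofReal_le_ofReal ((hC n x y).trans ?_)).trans ?_
    · rw [Metric.mem_closedBall, Real.dist_eq] at hx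
      refine mul_le_mul_of_nonneg_left (Real.exp_le_exp.2 ?_) hP
      nlinarith
    · simp
  have hlow : ENNReal.ofReal (P * Real.exp (-(C / 2))) * volume S ≤ volume (g^[n] '' S) := by
    rw [L.volume_iterate_image n hS, ← setLIntegral_const]
    refine setLIntegral_mono' hS fun x hx => ENNReal.ofReal_le_ofReal ?_
    have hx := hSy hx
    rw [Metric.mem_closedBall, dist_comm, Real.dist_eq] at hx
    have h1 := hC n y x
    have h2 : Real.exp (C * |y - x|) ≤ Real.exp (C / 2) := Real.exp_le_exp.2 (by nlinarith)
    have h3 : 0 ≤ ∏ i ∈ Finset.range n, h (g^[i] x) := Finset.prod_nonneg fun i _ => (L.pos _).le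
    rw [Real.exp_neg, ← div_eq_mul_inv, div_le_iff₀ (Real.exp_pos _)]
    exact h1.trans (mul_le_mul_of_nonneg_left h2 h3)
  refine le_trans ?_ hlow
  calc ENNReal.ofReal (Real.exp (-C)) * volume S * volume (g^[n] '' Metric.closedBall y (1 / 2))
      ≤ ENNReal.ofReal (Real.exp (-C)) * volume S * ENNReal.ofReal (P * Real.exp (C / 2)) := by
        gcongr
    _ = ENNReal.ofReal (Real.exp (-C)) * ENNReal.ofReal (P * Real.exp (C / 2)) * volume S := by ring
    _ = ENNReal.ofReal (P * Real.exp (-(C / 2))) * volume S := by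
        rw [← ENNReal.ofReal_mul (Real.exp_nonneg _)]
        congr 2
        rw [mul_left_comm, ← Real.exp_add]
        ring_nf

theorem image_iterate_closedBall (L : LiftPair m F g h) (n : ℕ) (y : ℝ) :
    g^[n] '' Metric.closedBall y (1 / 2) =
      Metric.closedBall ((g^[n] (y - 1 / 2) + g^[n] (y + 1 / 2)) / 2)
        ((g^[n] (y + 1 / 2) - g^[n] (y - 1 / 2)) / 2) := by
  have hmono : StrictMono g^[n] := L.strictMono.iterate n
  rw [Real.closedBall_eq_Icc, Real.closedBall_eq_Icc]
  ext x
  constructor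
  · rintro ⟨z, hz, rfl⟩
    have h1 := hmono.monotone hz.1
    have h2 := hmono.monotone hz.2
    constructor <;> linarith
  · intro hx
    have hr : g^[n] (F^[n] x) = x := (Function.LeftInverse.iterate L.left n) x
    refine ⟨F^[n] x, ⟨?_, ?_⟩, hr⟩
    · rw [← hmono.le_iff_le, hr]; linarith [hx.1]
    · rw [← hmono.le_iff_le, hr]; linarith [hx.2]

theorem circleErgodic (L : LiftPair m F g h) {K : ℝ} (hK : ∀ x y, |h x - h y| ≤ K * |x - y|) :
    CircleErgodic F := by
  intro φ hφ A hA hinv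
  obtain ⟨C, hC0, hC⟩ := L.exists_prod_iterate_le hK
  obtain ⟨ρ, hρ0, hρ1, hρ⟩ := L.exists_upper
  by_contra! hcon
  set B : Set ℝ := (fun x : ℝ => (x : AddCircle (1 : ℝ))) ⁻¹' A with hB
  have hBm : MeasurableSet B := AddCircle.measurable_mk' hA
  have hBF : ∀ x, F x ∈ B ↔ x ∈ B := by
    intro x
    have : (x : AddCircle (1 : ℝ)) ∈ φ ⁻¹' A ↔ (x : AddCircle (1 : ℝ)) ∈ A := by rw [hinv]
    rwa [Set.mem_preimage, hφ] at this
  have hBg : ∀ (n : ℕ) y, g^[n] y ∈ B ↔ y ∈ B := by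
    intro n
    induction n with
    | zero => simp
    | succ n ih =>
      intro y
      rw [Function.iterate_succ_apply', ← hBF, L.right, ih]
  have hAc : volume Aᶜ ≠ 0 := by
    have : IsProbabilityMeasure (volume : Measure (AddCircle (1 : ℝ))) :=
      ⟨by simp [AddCircle.measure_univ]⟩
    exact fun h0 => hcon.2 ((prob_compl_eq_zero_iff hA).1 h0)
  have hvB : (volume.restrict B) ≠ 0 := by
    intro h0
    rw [Measure.restrict_eq_zero] at h0
    refine hcon.1 ?_
    rw [volume_addCircle_one hA 0]
    exact measure_mono_null Set.inter_subset_left h0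
  obtain ⟨x, hx⟩ : ∃ x, ∀ (w : ℕ → ℝ) (δ : ℕ → ℝ), Tendsto δ atTop (𝓝[>] 0) →
      (∀ᶠ j in atTop, x ∈ Metric.closedBall (w j) (1 * δ j)) →
      Tendsto (fun j => volume (B ∩ Metric.closedBall (w j) (δ j)) /
        volume (Metric.closedBall (w j) (δ j))) atTop (𝓝 1) := by
    have : (ae (volume.restrict B)).NeBot := ae_neBot.2 hvB
    obtain ⟨x, hx⟩ := (IsUnifLocDoublingMeasure.ae_tendsto_measure_inter_div volume B 1).exists
    exact ⟨x, fun w δ h1 h2 => hx w δ h1 h2⟩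
  let w : ℕ → ℝ := fun n => (g^[n] (F^[n] x - 1 / 2) + g^[n] (F^[n] x + 1 / 2)) / 2
  let δ : ℕ → ℝ := fun n => (g^[n] (F^[n] x + 1 / 2) - g^[n] (F^[n] x - 1 / 2)) / 2
  have hball : ∀ n, g^[n] '' Metric.closedBall (F^[n] x) (1 / 2) = Metric.closedBall (w n) (δ n) :=
    fun n => L.image_iterate_closedBall n _
  have hδpos : ∀ n, 0 < δ n := fun n => by
    have := (L.strictMono.iterate n) (show F^[n] x - 1 / 2 < F^[n] x + 1 / 2 by linarith)
    simp only [δ]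
    linarith
  have hδ : Tendsto δ atTop (𝓝[>] 0) := by
    refine tendsto_nhdsWithin_iff.2 ⟨?_, Eventually.of_forall hδpos⟩
    refine squeeze_zero (fun n => (hδpos n).le) (fun n => ?_)
      (tendsto_pow_atTop_nhds_zero_of_lt_one hρ0.le hρ1)
    have h1 := L.abs_iterate_sub_le hρ0.le hρ n (F^[n] x + 1 / 2) (F^[n] x - 1 / 2)
    have h2 : |F^[n] x + 1 / 2 - (F^[n] x - 1 / 2)| = 1 := by ring_nf; norm_num
    rw [h2] at h1
    have h3 := le_abs_self (g^[n] (F^[n] x + 1 / 2) - g^[n] (F^[n] x - 1 / 2))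
    have h4 := pow_pos hρ0 n
    simp only [δ]
    linarith
  have hlim := hx w δ hδ (Eventually.of_forall fun n => by
    rw [one_mul, ← hball]
    exact ⟨F^[n] x, by simp, (Function.LeftInverse.iterate L.left n) x⟩)
  set κ : ℝ≥0∞ := ENNReal.ofReal (Real.exp (-C)) * volume Aᶜ
  have hle : ∀ n, volume (B ∩ Metric.closedBall (w n) (δ n)) /
        volume (Metric.closedBall (w n) (δ n)) + κ ≤ 1 := by
    intro n
    have hS := L.le_volume_image hC0 hC n (F^[n] x) (measurableSet_closedBall.diff hBm)
      Set.sdiff_subset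
    have hAc_le : volume Aᶜ ≤ volume (Metric.closedBall (F^[n] x) (1 / 2) \ B) := by
      rw [volume_addCircle_one hA.compl (F^[n] x - 1 / 2)]
      refine measure_mono fun z hz => ⟨?_, hz.1⟩
      rw [Real.closedBall_eq_Icc]
      exact ⟨hz.2.1.le, by linarith [hz.2.2]⟩
    have himg : g^[n] '' (Metric.closedBall (F^[n] x) (1 / 2) \ B) =
        Metric.closedBall (w n) (δ n) \ B := by
      rw [← hball]
      ext z
      constructor
      · rintro ⟨u, hu, rfl⟩
        exact ⟨⟨u, hu.1, rfl⟩, fun hz => hu.2 ((hBg n u).1 hz)⟩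
      · rintro ⟨⟨u, hu, rfl⟩, hz⟩
        exact ⟨u, ⟨hu, fun hz' => hz ((hBg n u).2 hz')⟩, rfl⟩
    rw [himg, hball] at hS
    set J := Metric.closedBall (w n) (δ n) with hJ
    have hJ0 : volume J ≠ 0 := (Metric.measure_closedBall_pos volume _ (hδpos n)).ne'
    have hJt : volume J ≠ ∞ := measure_closedBall_lt_top.ne
    have hκ : κ * volume J ≤ volume (J \ B) := le_trans (by simp only [κ]; gcongr) hS
    have hκ' : κ ≤ volume (J \ B) / volume J := by
      rwa [ENNReal.le_div_iff_mul_le (Or.inl hJ0) (Or.inl hJt)]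
    calc _ ≤ volume (B ∩ J) / volume J + volume (J \ B) / volume J := by gcongr
      _ = 1 := by
        rw [← ENNReal.add_div, Set.inter_comm, measure_inter_add_sdiff _ hBm,
          ENNReal.div_self hJ0 hJt]
  have h1 := le_of_tendsto' (hlim.add_const κ) hle
  have h2 : κ = 0 := by
    by_contra h0
    exact absurd h1 (not_le.2 (ENNReal.lt_add_right ENNReal.one_ne_top h0))
  simp only [κ, mul_eq_zero, ENNReal.ofReal_eq_zero, not_le.2 (Real.exp_pos _), false_or] at h2
  exact hAc h2

end LiftPair

/-- A Lipschitz periodic bump, equal to `1` at the origin and vanishing away from it. -/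
theorem exists_periodic_bump {m : ℕ} (hm : 2 ≤ m) {a : ℝ} (ha0 : 0 < a) (ha : a ≤ 1 / 2) :
    ∃ (T : ℝ → ℝ) (K : ℝ), (∀ x y, |T x - T y| ≤ K * |x - y|) ∧ (∀ x, T (x + m) = T x) ∧
      T 0 = 1 ∧ (∀ x, 0 ≤ T x) ∧ (∀ x, T x ≤ 1) ∧ (∀ t ∈ Set.Icc a 1, T t = 0) ∧ T (-1) = 0 := by
  have hm2 : (2 : ℝ) ≤ m := by exact_mod_cast hm
  have hm0 : (0 : ℝ) < m := by linarith
  let k : ℝ := m / (2 * a)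
  have hk : 0 < k := by positivity
  let T : ℝ → ℝ := fun x => max 0 (1 - k * |Real.sin (Real.pi / m * x)|)
  have hzero : ∀ t ∈ Set.Icc a 1, 1 ≤ k * |Real.sin (Real.pi / m * t)| := by
    intro t ht
    have ht0 : 0 < t := ha0.trans_le ht.1
    have h1 : Real.pi / m * t ≤ Real.pi / 2 := by
      have : Real.pi / m ≤ Real.pi / 2 := by gcongr
      have h2 : 0 < Real.pi / m := by positivity
      nlinarith [ht.2]
    have h2 := Real.mul_le_sin (x := Real.pi / m * t) (by positivity) h1
    have h3 : 2 / Real.pi * (Real.pi / m * t) = 2 * t / m := by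
      field_simp
    rw [h3] at h2
    have h4 : k * (2 * t / m) = t / a := by simp only [k]; field_simp
    have h5 : 1 ≤ t / a := (one_le_div ha0).2 ht.1
    calc 1 ≤ k * (2 * t / m) := by rw [h4]; exact h5
      _ ≤ k * |Real.sin (Real.pi / m * t)| :=
        mul_le_mul_of_nonneg_left (h2.trans (le_abs_self _)) hk.le
  have hT0 : ∀ t, 1 ≤ k * |Real.sin (Real.pi / m * t)| → T t = 0 := fun t ht =>
    max_eq_left (by linarith)
  refine ⟨T, k * (Real.pi / m), fun x y => ?_, fun x => ?_, ?_, fun x => le_max_left _ _,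
    fun x => ?_, fun t ht => hT0 t (hzero t ht), ?_⟩
  · have hsin : |Real.sin (Real.pi / m * x) - Real.sin (Real.pi / m * y)| ≤
        Real.pi / m * |x - y| := by
      have := Real.lipschitzWith_sin.dist_le_mul (Real.pi / m * x) (Real.pi / m * y)
      rw [Real.dist_eq, Real.dist_eq, ← mul_sub, abs_mul,
        abs_of_pos (by positivity : 0 < Real.pi / m)] at this
      simpa using this
    calc |T x - T y| ≤ |(1 - k * |Real.sin (Real.pi / m * x)|) -
          (1 - k * |Real.sin (Real.pi / m * y)|)| := by
          have := abs_max_sub_max_le_abs (1 - k * |Real.sin (Real.pi / m * x)|)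
            (1 - k * |Real.sin (Real.pi / m * y)|) 0
          simpa only [T, max_comm (0 : ℝ)] using this
      _ = k * |(|Real.sin (Real.pi / m * y)| - |Real.sin (Real.pi / m * x)|)| := by
          rw [show (1 - k * |Real.sin (Real.pi / m * x)|) - (1 - k * |Real.sin (Real.pi / m * y)|) =
            k * (|Real.sin (Real.pi / m * y)| - |Real.sin (Real.pi / m * x)|) by ring, abs_mul,
            abs_of_pos hk]
      _ ≤ k * |Real.sin (Real.pi / m * y) - Real.sin (Real.pi / m * x)| :=
          mul_le_mul_of_nonneg_left (abs_abs_sub_abs_le_abs_sub _ _) hk.le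
      _ ≤ k * (Real.pi / m * |x - y|) := by
          rw [abs_sub_comm]
          exact mul_le_mul_of_nonneg_left hsin hk.le
      _ = k * (Real.pi / m) * |x - y| := by ring
  · have : Real.pi / m * (x + m) = Real.pi / m * x + Real.pi := by field_simp
    simp only [T, this, Real.sin_add_pi, abs_neg]
  · simp [T]
  · have := mul_nonneg hk.le (abs_nonneg (Real.sin (Real.pi / m * x)))
    exact max_le zero_le_one (by linarith)
  · refine hT0 _ ?_
    have := hzero 1 ⟨by linarith, le_rfl⟩
    rwa [mul_neg, Real.sin_neg, abs_neg]

namespace LiftPair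

variable {m : ℕ} {F g h : ℝ → ℝ}

theorem exists_lipschitz_approx (L : LiftPair m F g h)
    (hsum : ∀ y, ∑ i ∈ Finset.range m, h (y + i) = 1) {ε : ℝ} (hε : 0 < ε) :
    ∃ (h' : ℝ → ℝ) (K : ℝ), (∀ x y, |h' x - h' y| ≤ K * |x - y|) ∧
      (∀ y, ∑ i ∈ Finset.range m, h' (y + i) = 1) ∧ ∀ y, |h' y - h y| ≤ ε := by
  obtain ⟨δ', hδ', hu⟩ := Metric.uniformContinuous_iff.1 L.uniformContinuous ε hε
  set δ := δ' / 2
  have hδ : 0 < δ := by positivity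
  refine ⟨fun x => (g (x + δ) - g x) / δ, 2 / δ, fun x y => ?_, fun y => ?_, fun y => ?_⟩
  · have h1 := L.abs_sub_le (fun y => (L.lt_one y).le) (x + δ) (y + δ)
    have h2 := L.abs_sub_le (fun y => (L.lt_one y).le) x y
    rw [← sub_div, abs_div, abs_of_pos hδ, div_mul_eq_mul_div]
    gcongr
    rw [show g (x + δ) - g x - (g (y + δ) - g y) = (g (x + δ) - g (y + δ)) - (g x - g y) by ring]
    refine (abs_sub _ _).trans ?_
    rw [add_sub_add_right_eq_sub] at h1
    linarith
  · have hS : ∀ x, HasDerivAt (fun x => ∑ i ∈ Finset.range m, g (x + i)) 1 x := by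
      intro x
      rw [← hsum x]
      exact HasDerivAt.fun_sum fun i _ => (L.hasDerivAt (x + i)).comp_add_const x i
    have h1 := sub_eq_of_hasDerivAt_one hS y (y + δ)
    rw [← Finset.sum_div, Finset.sum_sub_distrib, div_eq_one_iff_eq hδ.ne']
    simp only [add_right_comm y _ δ]
    linarith
  · obtain ⟨ξ, hξ, hs⟩ := exists_hasDerivAt_eq_slope g h (show y < y + δ by linarith)
      L.differentiable.continuous.continuousOn (fun x _ => L.hasDerivAt x)
    rw [add_sub_cancel_left] at hs
    simp only
    rw [← hs]
    refine (hu ?_).le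
    rw [Real.dist_eq, abs_lt]
    constructor <;> linarith [hξ.1, hξ.2, show δ = δ' / 2 from rfl]

/-- A small Lipschitz perturbation of `h` whose value at `q` is much smaller than the values at all
points between `q + c ^ N * η` and `q + η`. -/
theorem exists_perturbation (L : LiftPair m F g h)
    (hsum : ∀ y, ∑ i ∈ Finset.range m, h (y + i) = 1) (q M : ℝ) {ε : ℝ} (hε : 0 < ε) :
    ∃ (h' : ℝ → ℝ) (K c η e : ℝ) (N : ℕ), (∀ x y, |h' x - h' y| ≤ K * |x - y|) ∧
      (∀ y, ∑ i ∈ Finset.range m, h' (y + i) = 1) ∧ (∀ y, |h' y - h y| ≤ ε) ∧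
      0 < c ∧ (∀ y, c ≤ h' y) ∧ 0 < η ∧ η < 1 ∧ 0 ≤ e ∧ 1 ≤ N ∧ M < N * e ∧
      ∀ t ∈ Set.Icc (c ^ N * η) η, h' q + e ≤ h' (q + t) := by
  obtain ⟨c, hc0, hc1, hc⟩ := L.exists_lower
  set ε₀ := min (ε / 2) (c / 4) with hε₀
  have hε₀pos : 0 < ε₀ := lt_min (by positivity) (by positivity)
  have hε₀1 : ε₀ ≤ ε / 2 := min_le_left _ _
  have hε₀2 : ε₀ ≤ c / 4 := min_le_right _ _
  obtain ⟨δ, hδ, hu⟩ := Metric.uniformContinuous_iff.1 L.uniformContinuous (ε₀ / 4) (by positivity)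
  set η := min (δ / 2) (1 / 2) with hη
  have hη0 : 0 < η := lt_min (by positivity) (by norm_num)
  have hη1 : η ≤ δ / 2 := min_le_left _ _
  have hη2 : η ≤ 1 / 2 := min_le_right _ _
  obtain ⟨N, hN⟩ := exists_nat_gt (max 1 (M / (ε₀ / 4)))
  have hN1 : 1 ≤ N := by
    have := (le_max_left _ _).trans_lt hN
    exact_mod_cast this.le
  have hNM : M < N * (ε₀ / 4) := by
    rw [← div_lt_iff₀ (by positivity)]
    exact (le_max_right _ _).trans_lt hN
  have ha0 : 0 < (c / 2) ^ N * η := by positivity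
  have ha : (c / 2) ^ N * η ≤ 1 / 2 := by
    have : (c / 2) ^ N ≤ 1 := pow_le_one₀ (by positivity) (by linarith)
    nlinarith
  obtain ⟨T, K₁, hTL, hTp, hT0, hTn, hT1, hTz, hTm⟩ := exists_periodic_bump L.two_le ha0 ha
  obtain ⟨h₁, K₂, h₁L, h₁s, h₁a⟩ := L.exists_lipschitz_approx hsum (ε := ε₀ / 4) (by positivity)
  set v : ℝ → ℝ := fun x => ε₀ * (T (x - q - 1) - T (x - q)) with hv
  have hvabs : ∀ x, |v x| ≤ ε₀ := by
    intro x
    rw [hv, abs_mul, abs_of_pos hε₀pos]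
    refine mul_le_of_le_one_right hε₀pos.le (abs_le.2 ⟨?_, ?_⟩) <;>
      linarith [hTn (x - q - 1), hTn (x - q), hT1 (x - q - 1), hT1 (x - q)]
  have hclose : ∀ y, |h₁ y + v y - h y| ≤ 5 / 4 * ε₀ := by
    intro y
    rw [show h₁ y + v y - h y = (h₁ y - h y) + v y by ring]
    refine (abs_add_le _ _).trans ?_
    linarith [h₁a y, hvabs y]
  refine ⟨fun x => h₁ x + v x, K₂ + ε₀ * (2 * K₁), c / 2, η, ε₀ / 4, N, fun x y => ?_, fun y => ?_,
    fun y => (hclose y).trans (by linarith), by positivity, fun y => ?_, hη0, by linarith,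
    by positivity, hN1, hNM, fun t ht => ?_⟩
  · have e1 : h₁ x + v x - (h₁ y + v y) = (h₁ x - h₁ y) +
        ε₀ * ((T (x - q - 1) - T (y - q - 1)) - (T (x - q) - T (y - q))) := by
      simp only [hv]; ring
    have e2 := hTL (x - q - 1) (y - q - 1)
    have e3 := hTL (x - q) (y - q)
    rw [show x - q - 1 - (y - q - 1) = x - y by ring] at e2
    rw [show x - q - (y - q) = x - y by ring] at e3
    rw [e1, add_mul, mul_assoc ε₀]
    refine (abs_add_le _ _).trans (add_le_add (h₁L x y) ?_)
    rw [abs_mul, abs_of_pos hε₀pos]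
    refine mul_le_mul_of_nonneg_left ((abs_sub _ _).trans ?_) hε₀pos.le
    linarith
  · rw [Finset.sum_add_distrib, h₁s, ← Finset.mul_sum, Finset.sum_sub_distrib]
    have e1 := antiperiod_sum_zero T m (y - q - 1)
    rw [hTp, sub_add_cancel, sub_self] at e1
    have e2 : ∀ i : ℕ, y + i - q = y - q + i := fun i => by ring
    have e3 : ∀ i : ℕ, y - q - 1 + i = y - q + i - 1 := fun i => by ring
    simp only [e3] at e1
    simp only [e2]
    rw [← neg_sub, e1]
    simp
  · have := (abs_le.1 (hclose y)).1
    have := hc y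
    linarith
  · have ht0 : 0 < t := ha0.trans_le ht.1
    have e1 : T t = 0 := hTz t ⟨ht.1, by linarith [ht.2]⟩
    have e2 : v q = -ε₀ := by simp [hv, hTm, hT0]
    have e3 : 0 ≤ v (q + t) := by
      simp only [hv, add_sub_cancel_left, e1, sub_zero]
      exact mul_nonneg hε₀pos.le (hTn _)
    have e4 : |h (q + t) - h q| < ε₀ / 4 := hu (by
      rw [Real.dist_eq, add_sub_cancel_left, abs_of_pos ht0]
      linarith [ht.2])
    have e5 := abs_le.1 (h₁a q)
    have e6 := abs_le.1 (h₁a (q + t))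
    have e7 := abs_lt.1 e4
    simp only
    linarith [e5.2, e6.1, e7.1]

theorem iterate_add_int (L : LiftPair m F g h) (j : ℤ) (k : ℕ) (x : ℝ) :
    F^[k] (x + j) = F^[k] x + m ^ k * j := by
  induction k generalizing x j with
  | zero => simp
  | succ k ih =>
    rw [Function.iterate_succ_apply, Function.iterate_succ_apply, L.map_add_int]
    have := ih (m * j) (F x)
    push_cast at this
    rw [this, pow_succ]
    ring

theorem exists_hasDerivAt_iterate_fwd (L : LiftPair m F g h) (k : ℕ) (x : ℝ) :
    ∃ d, 0 < d ∧ HasDerivAt F^[k] d x := by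
  induction k generalizing x with
  | zero => exact ⟨1, one_pos, by simpa using hasDerivAt_id x⟩
  | succ k ih =>
    obtain ⟨d, hd, hd'⟩ := ih (F x)
    refine ⟨d * (h (F x))⁻¹, mul_pos hd (inv_pos.2 (L.pos _)), ?_⟩
    rw [Function.iterate_succ]
    exact hd'.comp x (L.hasDerivAt_fwd x)

theorem deriv_iterate_add_int (L : LiftPair m F g h) (j : ℤ) (k : ℕ) (x : ℝ) :
    deriv F^[k] (x + j) = deriv F^[k] x := by
  have h1 := deriv_comp_add_const F^[k] (j : ℝ) x
  rw [← h1, funext (L.iterate_add_int j k), deriv_add_const]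

theorem log_deriv_iterate_succ (L : LiftPair m F g h) (k : ℕ) (x : ℝ) :
    Real.log (deriv F^[k + 1] x) = Real.log (deriv F^[k] (F x)) - Real.log (h (F x)) := by
  obtain ⟨d, hd, hd'⟩ := L.exists_hasDerivAt_iterate_fwd k (F x)
  have h1 : HasDerivAt F^[k + 1] (d * (h (F x))⁻¹) x := by
    rw [Function.iterate_succ]
    exact hd'.comp x (L.hasDerivAt_fwd x)
  rw [h1.deriv, hd'.deriv, Real.log_mul hd.ne' (inv_pos.2 (L.pos _)).ne', Real.log_inv,
    sub_eq_add_neg]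

/-- Slow decay of the backward orbit towards a fixed point `p` forces large distortion when the
derivative of the inverse jumps at `p`. -/
theorem exists_large_distortion (L : LiftPair m F g h) {p c η e : ℝ} {j : ℤ} {N : ℕ}
    (hp : F p = p + j) (hc0 : 0 < c) (hc : ∀ y, c ≤ h y) (hη0 : 0 < η) (hη1 : η < 1)
    (hjump : ∀ t ∈ Set.Icc (c ^ N * η) η, h (p + j) + e ≤ h (p + j + t)) (he : 0 ≤ e) :
    ∃ x y, |F^[N] x - F^[N] y| < 1 ∧
      N * e ≤ Real.log (deriv F^[N] x) - Real.log (deriv F^[N] y) := by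
  have hc1 : c ≤ 1 := (hc 0).trans (L.lt_one 0).le
  have key : ∀ k : ℕ, k ≤ N → ∃ t, c ^ k * η ≤ t ∧ t ≤ η ∧ F^[k] (p + t) - F^[k] p = η ∧
      k * e ≤ Real.log (deriv F^[k] p) - Real.log (deriv F^[k] (p + t)) := by
    intro k
    induction k with
    | zero => exact fun _ => ⟨η, by simp, le_rfl, by simp, by simp⟩
    | succ k ih =>
      intro hk
      obtain ⟨t, ht1, ht2, ht3, ht4⟩ := ih (by lia)
      have ht0 : 0 < t := (by positivity : 0 < c ^ k * η).trans_le ht1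
      have hgp : g (p + j) = p := by rw [← hp, L.left]
      have hlow := L.le_abs_sub hc (p + j + t) (p + j)
      have hup := L.abs_sub_le (fun y => (L.lt_one y).le) (p + j + t) (p + j)
      rw [abs_of_pos (a := g (p + j + t) - g (p + j))
        (sub_pos.2 (L.strictMono (by linarith))), add_sub_cancel_left, abs_of_pos ht0,
        hgp] at hlow hup
      have hF : F (p + (g (p + j + t) - p)) = p + t + j := by
        rw [add_sub_cancel, L.right]; ring
      refine ⟨g (p + j + t) - p, ?_, by linarith, ?_, ?_⟩
      · rw [pow_succ']
        nlinarith
      · rw [Function.iterate_succ_apply, Function.iterate_succ_apply, hF, hp, L.iterate_add_int,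
          L.iterate_add_int]
        linarith
      · rw [L.log_deriv_iterate_succ, L.log_deriv_iterate_succ, hF, hp, L.deriv_iterate_add_int,
          L.deriv_iterate_add_int]
        have hmem : t ∈ Set.Icc (c ^ N * η) η := by
          refine ⟨le_trans ?_ ht1, ht2⟩
          exact mul_le_mul_of_nonneg_right (pow_le_pow_of_le_one hc0.le hc1 (by lia)) hη0.le
        have hj := hjump t hmem
        have ha := L.pos (p + j)
        have hb := L.pos (p + j + t)
        have hb1 := L.lt_one (p + j + t)
        have hlog := Real.one_sub_inv_le_log_of_pos (div_pos hb ha)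
        rw [Real.log_div hb.ne' ha.ne', inv_div, one_sub_div hb.ne'] at hlog
        have : e ≤ (h (p + j + t) - h (p + j)) / h (p + j + t) := by
          rw [le_div_iff₀ hb]
          nlinarith
        rw [add_right_comm p t]
        push_cast
        linarith
  obtain ⟨t, -, -, h3, h4⟩ := key N le_rfl
  refine ⟨p, p + t, ?_, h4⟩
  rw [abs_sub_comm, h3, abs_of_pos hη0]
  exact hη1

theorem exists_fixed (L : LiftPair m F g h) : ∃ (p : ℝ) (j : ℤ), F p = p + j := by
  have hm : (2 : ℝ) ≤ m := by exact_mod_cast L.two_le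
  have h1 : F 1 = F 0 + m := by simpa using L.map_add_one 0
  have hcont : ContinuousOn (fun x => F x - x) (Set.Icc 0 1) :=
    (L.continuous_fwd.sub continuous_id).continuousOn
  obtain ⟨p, -, hp⟩ := intermediate_value_Icc zero_le_one hcont
    (show ((⌈F 0⌉ : ℤ) : ℝ) ∈ Set.Icc (F 0 - 0) (F 1 - 1) from
      ⟨by simpa using Int.le_ceil (F 0), by rw [h1]; linarith [Int.ceil_lt_add_one (F 0)]⟩)
  exact ⟨p, ⌈F 0⌉, by simp only at hp; linarith⟩

/-- The lift depends continuously, in the `C¹` sense, on the derivative of its inverse. -/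
theorem exists_close (L : LiftPair m F g h) {ε : ℝ} (hε : 0 < ε) :
    ∃ δ > 0, ∀ {G γ h' : ℝ → ℝ}, LiftPair m G γ h' → (∀ y, |h' y - h y| ≤ δ) →
      (∃ q, γ q = g q) → ∀ x, |G x - F x| ≤ ε ∧ |deriv G x - deriv F x| ≤ ε := by
  obtain ⟨c, hc0, hc1, hc⟩ := L.exists_lower
  have hm : (2 : ℝ) ≤ m := by exact_mod_cast L.two_le
  obtain ⟨δ₁, hδ₁, hu⟩ := Metric.uniformContinuous_iff.1 L.uniformContinuous (ε * c ^ 2 / 4)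
    (by positivity)
  set δ := min (min (c / 2) (ε * c ^ 2 / 4)) (min ε (δ₁ / 2) * c / m) with hδ
  have hδpos : 0 < δ := lt_min (lt_min (by positivity) (by positivity)) (by
    have : 0 < min ε (δ₁ / 2) := lt_min hε (by positivity)
    positivity)
  have hδa : δ ≤ c / 2 := (min_le_left _ _).trans (min_le_left _ _)
  have hδb : δ ≤ ε * c ^ 2 / 4 := (min_le_left _ _).trans (min_le_right _ _)
  have hδc : δ * m ≤ c * min ε (δ₁ / 2) := by
    have : δ ≤ min ε (δ₁ / 2) * c / m := min_le_right _ _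
    rw [le_div_iff₀ (by linarith)] at this
    linarith
  refine ⟨δ, hδpos, fun {G γ h'} L' hclose ⟨q, hq⟩ x => ?_⟩
  have hD : ∀ y, HasDerivAt (fun y => γ y - g y) (h' y - h y) y :=
    fun y => (L'.hasDerivAt y).sub (L.hasDerivAt y)
  have hDper : Function.Periodic (fun y => γ y - g y) m := by
    intro y
    simp only [L.shift, L'.shift]
    ring
  have hDle : ∀ y, |γ y - g y| ≤ δ * m := by
    intro y
    obtain ⟨z, hz, hyz⟩ := hDper.exists_mem_Ico (by linarith : (0 : ℝ) < m) y q
    have h1 := convex_univ.norm_image_sub_le_of_norm_hasDerivWithin_le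
      (fun y _ => (hD y).hasDerivWithinAt) (fun y _ => hclose y) (Set.mem_univ q) (Set.mem_univ z)
    simp only [Real.norm_eq_abs, hq, sub_self, sub_zero] at h1
    have hyz' : γ y - g y = γ z - g z := hyz
    rw [hyz']
    refine h1.trans (mul_le_mul_of_nonneg_left ?_ hδpos.le)
    rw [abs_of_nonneg (by linarith [hz.1])]
    linarith [hz.2]
  have hdist : |G x - F x| ≤ min ε (δ₁ / 2) := by
    have h1 := L.le_abs_sub hc (G x) (F x)
    have h2 := hDle (G x)
    rw [L'.left, abs_sub_comm] at h2
    rw [L.left] at h1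
    nlinarith
  refine ⟨hdist.trans (min_le_left _ _), ?_⟩
  rw [(L.hasDerivAt_fwd x).deriv, (L'.hasDerivAt_fwd x).deriv]
  have hb : c / 2 ≤ h' (G x) := by
    have := (abs_le.1 (hclose (G x))).1
    linarith [hc (G x)]
  have ha := hc (F x)
  have h3 : |h (F x) - h' (G x)| ≤ ε * c ^ 2 / 2 := by
    have h4 : |h (F x) - h (G x)| < ε * c ^ 2 / 4 := hu (by
      rw [dist_comm, Real.dist_eq]
      have := hdist.trans (min_le_right _ _)
      linarith)
    have h5 := hclose (G x)
    rw [abs_sub_comm] at h5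
    have := abs_add_le (h (F x) - h (G x)) (h (G x) - h' (G x))
    rw [sub_add_sub_cancel] at this
    linarith
  rw [inv_sub_inv (L'.pos _).ne' (L.pos _).ne', abs_div,
    abs_of_pos (mul_pos (L'.pos _) (L.pos _)), div_le_iff₀ (mul_pos (L'.pos _) (L.pos _))]
  refine h3.trans ?_
  have : c / 2 * c ≤ h' (G x) * h (F x) := mul_le_mul hb ha hc0.le (L'.pos _).le
  nlinarith

end LiftPair

namespace LiftPair

variable {m : ℕ} {F g h : ℝ → ℝ}

theorem log_deriv_iterate (L : LiftPair m F g h) (k : ℕ) (x : ℝ) :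
    Real.log (deriv F^[k] x) = ∑ i ∈ Finset.range k, Real.log (deriv F (F^[i] x)) := by
  induction k generalizing x with
  | zero => simp
  | succ k ih =>
    rw [L.log_deriv_iterate_succ, ih, Finset.sum_range_succ']
    simp only [Function.iterate_succ_apply, Function.iterate_zero, id_eq]
    rw [(L.hasDerivAt_fwd x).deriv, Real.log_inv, sub_eq_add_neg]

end LiftPair

/-- The point of the unit interval congruent to `x` modulo `1`. -/
noncomputable def fractIcc (x : ℝ) : Set.Icc (0 : ℝ) 1 :=
  ⟨Int.fract x, Int.fract_nonneg x, (Int.fract_lt_one x).le⟩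

/-- The map of the line whose restriction to the unit interval is the first component of `p`. -/
noncomputable def extendFst (p : C(Set.Icc (0 : ℝ) 1, ℝ) × C(Set.Icc (0 : ℝ) 1, ℝ)) (x : ℝ) : ℝ :=
  p.1 (fractIcc x) + ⌊x⌋ * (p.1 1 - p.1 0)

/-- The `1`-periodic map of the line whose restriction to `[0, 1)` is the second component
of `p`. -/
noncomputable def extendSnd (p : C(Set.Icc (0 : ℝ) 1, ℝ) × C(Set.Icc (0 : ℝ) 1, ℝ)) (x : ℝ) : ℝ :=
  p.2 (fractIcc x)

theorem LiftPair.eq_extend {m : ℕ} {F g h : ℝ → ℝ} (L : LiftPair m F g h)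
    {p : C(Set.Icc (0 : ℝ) 1, ℝ) × C(Set.Icc (0 : ℝ) 1, ℝ)} (hp : RepresentsPair p F) :
    F = extendFst p ∧ deriv F = extendSnd p := by
  refine ⟨funext fun x => ?_, funext fun x => ?_⟩
  · have h1 := L.map_add_int (Int.fract x) ⌊x⌋
    have h2 := L.map_add_one 0
    rw [Int.fract_add_floor] at h1
    rw [extendFst, (hp _).1, (hp 1).1, (hp 0).1, h1]
    simp only [fractIcc, Set.Icc.coe_one, Set.Icc.coe_zero]
    rw [zero_add] at h2
    rw [h2]
    ring
  · have h1 := L.deriv_iterate_add_int ⌊x⌋ 1 (Int.fract x)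
    rw [Int.fract_add_floor, Function.iterate_one] at h1
    rw [extendSnd, (hp _).2, h1, fractIcc]

theorem abs_extendFst_sub_le (p q : C(Set.Icc (0 : ℝ) 1, ℝ) × C(Set.Icc (0 : ℝ) 1, ℝ)) (x : ℝ) :
    |extendFst p x - extendFst q x| ≤ (3 + 2 * |x|) * dist p q := by
  have h : ∀ a, |p.1 a - q.1 a| ≤ dist p q := fun a =>
    (ContinuousMap.dist_apply_le_dist (f := p.1) (g := q.1) a).trans (le_max_left _ _)
  have hfl : |(⌊x⌋ : ℝ)| ≤ |x| + 1 := by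
    have h1 := Int.fract_add_floor x
    rw [show (⌊x⌋ : ℝ) = x - Int.fract x by linarith]
    refine (abs_sub _ _).trans ?_
    rw [abs_of_nonneg (Int.fract_nonneg x)]
    linarith [Int.fract_lt_one x]
  have e : extendFst p x - extendFst q x = (p.1 (fractIcc x) - q.1 (fractIcc x)) +
      ⌊x⌋ * ((p.1 1 - q.1 1) - (p.1 0 - q.1 0)) := by
    simp only [extendFst]; ring
  rw [e]
  refine (abs_add_le _ _).trans ?_
  rw [abs_mul]
  have h2 : |(p.1 1 - q.1 1) - (p.1 0 - q.1 0)| ≤ 2 * dist p q := by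
    refine (abs_sub _ _).trans ?_
    linarith [h 1, h 0]
  have h3 := mul_le_mul hfl h2 (abs_nonneg _) (by positivity)
  linarith [h (fractIcc x)]

theorem continuousAt_extendFst {p₀ : C(Set.Icc (0 : ℝ) 1, ℝ) × C(Set.Icc (0 : ℝ) 1, ℝ)}
    (hc : Continuous (extendFst p₀)) (x₀ : ℝ) :
    ContinuousAt (fun z : (C(Set.Icc (0 : ℝ) 1, ℝ) × C(Set.Icc (0 : ℝ) 1, ℝ)) × ℝ =>
      extendFst z.1 z.2) (p₀, x₀) := by
  rw [ContinuousAt, tendsto_iff_dist_tendsto_zero]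
  have hlim : Tendsto (fun z : (C(Set.Icc (0 : ℝ) 1, ℝ) × C(Set.Icc (0 : ℝ) 1, ℝ)) × ℝ =>
      (3 + 2 * |z.2|) * dist z.1 p₀ + |extendFst p₀ z.2 - extendFst p₀ x₀|) (𝓝 (p₀, x₀)) (𝓝 0) := by
    have : Continuous (fun z : (C(Set.Icc (0 : ℝ) 1, ℝ) × C(Set.Icc (0 : ℝ) 1, ℝ)) × ℝ =>
      (3 + 2 * |z.2|) * dist z.1 p₀ + |extendFst p₀ z.2 - extendFst p₀ x₀|) := by fun_prop
    simpa using this.tendsto (p₀, x₀)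
  refine squeeze_zero (fun _ => dist_nonneg) (fun z => ?_) hlim
  rw [Real.dist_eq]
  refine (abs_sub_le _ (extendFst p₀ z.2) _).trans ?_
  gcongr
  exact abs_extendFst_sub_le _ _ _

theorem continuousAt_extendSnd {p₀ : C(Set.Icc (0 : ℝ) 1, ℝ) × C(Set.Icc (0 : ℝ) 1, ℝ)}
    (hc : Continuous (extendSnd p₀)) (x₀ : ℝ) :
    ContinuousAt (fun z : (C(Set.Icc (0 : ℝ) 1, ℝ) × C(Set.Icc (0 : ℝ) 1, ℝ)) × ℝ =>
      extendSnd z.1 z.2) (p₀, x₀) := by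
  rw [ContinuousAt, tendsto_iff_dist_tendsto_zero]
  have hlim : Tendsto (fun z : (C(Set.Icc (0 : ℝ) 1, ℝ) × C(Set.Icc (0 : ℝ) 1, ℝ)) × ℝ =>
      dist z.1 p₀ + |extendSnd p₀ z.2 - extendSnd p₀ x₀|) (𝓝 (p₀, x₀)) (𝓝 0) := by
    have : Continuous (fun z : (C(Set.Icc (0 : ℝ) 1, ℝ) × C(Set.Icc (0 : ℝ) 1, ℝ)) × ℝ =>
      dist z.1 p₀ + |extendSnd p₀ z.2 - extendSnd p₀ x₀|) := by fun_prop
    simpa using this.tendsto (p₀, x₀)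
  refine squeeze_zero (fun _ => dist_nonneg) (fun z => ?_) hlim
  rw [Real.dist_eq]
  refine (abs_sub_le _ (extendSnd p₀ z.2) _).trans ?_
  gcongr
  exact (ContinuousMap.dist_apply_le_dist (f := z.1.2) (g := p₀.2) _).trans (le_max_right _ _)

theorem continuousAt_iterate_extendFst
    {p₀ : C(Set.Icc (0 : ℝ) 1, ℝ) × C(Set.Icc (0 : ℝ) 1, ℝ)}
    (hc : Continuous (extendFst p₀)) (k : ℕ) (x : ℝ) :
    ContinuousAt (fun p => (extendFst p)^[k] x) p₀ := by
  induction k with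
  | zero => exact continuousAt_const
  | succ k ih =>
    simp only [Function.iterate_succ_apply']
    exact (continuousAt_extendFst hc ((extendFst p₀)^[k] x)).comp_of_eq
      (continuousAt_id.prodMk ih) rfl

/-- The elements of `Γ_{λ,er}` having some distortion larger than `M`. -/
def largeDistortion (M : ℝ) : Set ↥GammaLamErSet :=
  {p | ∃ (k : ℕ) (x y : ℝ), 1 ≤ k ∧ |(extendFst p)^[k] x - (extendFst p)^[k] y| < 1 ∧
    M < ∑ i ∈ Finset.range k, Real.log (extendSnd p ((extendFst p)^[i] x)) -
      ∑ i ∈ Finset.range k, Real.log (extendSnd p ((extendFst p)^[i] y))}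

theorem isOpen_largeDistortion (M : ℝ) : IsOpen (largeDistortion M) := by
  rw [isOpen_iff_mem_nhds]
  rintro ⟨p, hp⟩ ⟨k, x, y, hk, hxy, hM⟩
  obtain ⟨F, m, hF, -, -, hrep⟩ := id hp
  obtain ⟨n, g, h, -, L⟩ := hF.exists_liftPair
  obtain ⟨e1, e2⟩ := L.eq_extend hrep
  have hc1 : Continuous (extendFst p) := e1 ▸ L.continuous_fwd
  have hc2 : Continuous (extendSnd p) := e2 ▸ hF.2.1.continuous_deriv le_rfl
  have hpos : ∀ z, extendSnd p z ≠ 0 := fun z =>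
    (zero_lt_one.trans (e2 ▸ hF.2.2.2 z : 1 < extendSnd p z)).ne'
  have hsum : ∀ z, ContinuousAt
      (fun p => ∑ i ∈ Finset.range k, Real.log (extendSnd p ((extendFst p)^[i] z))) p := fun z =>
    tendsto_finsetSum _ fun i _ => ContinuousAt.log
      ((continuousAt_extendSnd hc2 ((extendFst p)^[i] z)).comp_of_eq
        (continuousAt_id.prodMk (continuousAt_iterate_extendFst hc1 i z)) rfl) (hpos _)
  have hA := ((continuousAt_iterate_extendFst hc1 k x).sub
    (continuousAt_iterate_extendFst hc1 k y)).abs.eventually_lt_const hxy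
  have hB := ((hsum x).sub (hsum y)).eventually_const_lt hM
  have hv : Tendsto (Subtype.val : ↥GammaLamErSet → _) (𝓝 ⟨p, hp⟩) (𝓝 p) :=
    continuous_subtype_val.continuousAt
  filter_upwards [hv.eventually hA, hv.eventually hB] with q hqA hqB
  exact ⟨k, x, y, hk, hqA, hqB⟩

theorem dense_largeDistortion (M : ℝ) : Dense (largeDistortion M) := by
  rw [Metric.dense_iff]
  rintro ⟨p, hp⟩ ε hε
  obtain ⟨F, m, hF, hpres, herg, hrep⟩ := id hp
  obtain ⟨n, g, h, -, L⟩ := hF.exists_liftPair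
  obtain ⟨a, j, ha⟩ := L.exists_fixed
  obtain ⟨δ, hδ, hclose⟩ := L.exists_close (half_pos hε)
  obtain ⟨h', K, c, η, e, N, hK, hsum, hh', hc0, hc, hη0, hη1, he, hN, hM, hjump⟩ :=
    L.exists_perturbation (L.sum_eq_one hpres) (a + j) M hδ
  have hcont : Continuous h' :=
    (LipschitzWith.of_dist_le' fun x y => by simpa only [Real.dist_eq] using hK x y).continuous
  obtain ⟨G, γ, L', hγ⟩ := exists_liftPair_of_sum_eq_one L.two_le hcont
    (fun y => hc0.trans_le (hc y)) hsum a (a + j)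
  have hGa : G a = a + j := by simpa only [hγ] using L'.right (a + j)
  have hGF := hclose L' hh' ⟨a + j, by rw [hγ, ← ha, L.left]⟩
  let q : C(Set.Icc (0 : ℝ) 1, ℝ) × C(Set.Icc (0 : ℝ) 1, ℝ) :=
    (⟨fun x => G x, L'.continuous_fwd.comp continuous_subtype_val⟩,
      ⟨fun x => deriv G x,
        (L'.isLiftDeg.2.1.continuous_deriv le_rfl).comp continuous_subtype_val⟩)
  have hq : RepresentsPair q G := fun x => ⟨rfl, rfl⟩
  refine ⟨⟨q, G, n, L'.isLiftDeg, L'.circlePreserves hsum, L'.circleErgodic hK, hq⟩, ?_, ?_⟩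
  · rw [Metric.mem_ball, Subtype.dist_eq, Prod.dist_eq]
    refine lt_of_le_of_lt (max_le ?_ ?_) (half_lt_self hε)
    · refine (ContinuousMap.dist_le (half_pos hε).le).2 fun x => ?_
      rw [Real.dist_eq, (hrep x).1]
      exact (hGF x).1
    · refine (ContinuousMap.dist_le (half_pos hε).le).2 fun x => ?_
      rw [Real.dist_eq, (hrep x).2]
      exact (hGF x).2
  · obtain ⟨x, y, hxy, hlog⟩ := L'.exists_large_distortion hGa hc0 hc hη0 hη1 hjump he
    rw [L'.log_deriv_iterate, L'.log_deriv_iterate] at hlog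
    obtain ⟨e1, e2⟩ := L'.eq_extend hq
    rw [e2] at hlog
    rw [e1] at hlog hxy
    exact ⟨N, x, y, hN, hxy, hM.trans_le hlog⟩

/-- main theorem, genericity of unbounded distortion: the set of
elements of `Γ_{λ,er}` with unbounded distortion is residual (comeagre) in
`Γ_{λ,er}` with the C¹ topology. -/
theorem unbounded_distortion_generic :
    {p : ↥GammaLamErSet | ∀ (F : ℝ → ℝ) (m : ℤ), IsLiftDeg m F →
        RepresentsPair (p : C(Set.Icc (0 : ℝ) 1, ℝ) × C(Set.Icc (0 : ℝ) 1, ℝ)) F →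
        UnboundedDistortionLift F} ∈ residual ↥GammaLamErSet := by
  have hres : (⋂ n : ℕ, largeDistortion n) ∈ residual ↥GammaLamErSet :=
    countable_iInter_mem.2 fun n =>
      residual_of_dense_open (isOpen_largeDistortion n) (dense_largeDistortion n)
  filter_upwards [hres] with p hp F m hF hrep M
  obtain ⟨n, hn⟩ := exists_nat_ge M
  obtain ⟨k, x, y, hk, hxy, hM⟩ := Set.mem_iInter.1 hp n
  obtain ⟨_, g, h, -, L⟩ := hF.exists_liftPair
  obtain ⟨e1, e2⟩ := L.eq_extend hrep
  refine ⟨k, hk, x, y, ?_, ?_⟩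
  · rw [e1]
    exact hxy.le
  · rw [L.log_deriv_iterate, L.log_deriv_iterate, e2, e1]
    exact hn.trans_lt hM
end

section
/- Continuity of the level-k distortion: for every k ≥ 1, the function F ↦ d_k(F) is real-valued and continuous on the set of all lifts of C¹ expanding circle maps (of any degree m ≥ 2), equipped with the C¹ topology. -/
open Set MeasureTheory

/-- The C¹ distance between two lifts:
`sup_{[0,1]} |F - G| + sup_{[0,1]} |F' - G'|`. -/
noncomputable def dC1 (F G : ℝ → ℝ) : ℝ :=
  sSup ((fun x => |F x - G x|) '' Set.Icc 0 1) +
  sSup ((fun x => |deriv F x - deriv G x|) '' Set.Icc 0 1)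

/-- The set of distortion values of `F` at level `k`, whose supremum is the
level-`k` distortion `d_k(F)`. -/
def DistSet (k : ℕ) (F : ℝ → ℝ) : Set ℝ :=
  {d | ∃ x y : ℝ, |F^[k] x - F^[k] y| ≤ 1 ∧
    d = Real.log (deriv (F^[k]) x) - Real.log (deriv (F^[k]) y)}

theorem Function.Periodic.uniformContinuous_of_continuous {f : ℝ → ℝ}
    (hp : Function.Periodic f 1) (hf : Continuous f) : UniformContinuous f := by
  rw [Metric.uniformContinuous_iff]
  intro ε hε
  obtain ⟨δ, hδ, h⟩ := Metric.uniformContinuousOn_iff.1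
    ((isCompact_Icc (a := (-1 : ℝ)) (b := 2)).uniformContinuousOn_of_continuous hf.continuousOn)
    ε hε
  refine ⟨min δ 1, by positivity, fun {x y} hxy => ?_⟩
  have hxy' := abs_lt.1 (hxy.trans_le (min_le_right _ _))
  have h₀ := Int.floor_le x
  have h₁ := Int.lt_floor_add_one x
  have key := h (x - ⌊x⌋) ⟨by linarith, by linarith⟩ (y - ⌊x⌋)
    ⟨by linarith [hxy'.1, hxy'.2], by linarith [hxy'.1, hxy'.2]⟩
    (by simpa using hxy.trans_le (min_le_left _ _))
  have hs : ∀ z, f (z - ⌊x⌋) = f z := fun z => by simpa using hp.sub_zsmul_eq ⌊x⌋ (x := z)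
  rwa [hs, hs] at key

namespace IsLiftDeg

variable {m m' : ℤ} {F G : ℝ → ℝ}

theorem continuous (hF : IsLiftDeg m F) : Continuous F := hF.2.1.continuous

theorem differentiable (hF : IsLiftDeg m F) : Differentiable ℝ F :=
  hF.2.1.differentiable one_ne_zero

theorem continuous_deriv (hF : IsLiftDeg m F) : Continuous (deriv F) :=
  hF.2.1.continuous_deriv le_rfl

theorem periodic_deriv (hF : IsLiftDeg m F) : Function.Periodic (deriv F) 1 := fun x => by
  rw [← deriv_comp_add_const, funext hF.2.2.1, deriv_add_const]

theorem comp (hF : IsLiftDeg m F) (hG : IsLiftDeg m' G) : IsLiftDeg (m * m') (F ∘ G) := by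
  have hint : ∀ (n : ℕ) (x : ℝ), F (x + n) = F x + m * n := fun n x => by
    induction n with
    | zero => simp
    | succ n ih =>
      push_cast
      rw [← add_assoc, hF.2.2.1, ih]
      ring
  refine ⟨by nlinarith [hF.1, hG.1], hF.2.1.comp hG.2.1, fun x => ?_, fun x => ?_⟩
  · obtain ⟨n, rfl⟩ := Int.eq_ofNat_of_zero_le (by linarith [hG.1] : 0 ≤ m')
    simpa [hG.2.2.1] using hint n (G x)
  · rw [deriv_comp x (hF.differentiable _) (hG.differentiable x)]
    exact one_lt_mul_of_lt_of_le (hF.2.2.2 _) (hG.2.2.2 x).le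

theorem iterate (hF : IsLiftDeg m F) {k : ℕ} (hk : 1 ≤ k) : IsLiftDeg (m ^ k) F^[k] := by
  induction k, hk using Nat.le_induction with
  | base => simpa using hF
  | succ k _ ih =>
    rw [Function.iterate_succ', pow_succ']
    exact hF.comp ih

theorem sub_le_image_sub (hF : IsLiftDeg m F) {x y : ℝ} (hxy : x ≤ y) : y - x ≤ F y - F x := by
  simpa using mul_sub_le_image_sub_of_le_deriv hF.differentiable
    (fun x => (hF.2.2.2 x).le) hxy

theorem abs_sub_le (hF : IsLiftDeg m F) (x y : ℝ) : |x - y| ≤ |F x - F y| := by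
  rcases le_total x y with h | h
  · rw [abs_sub_comm x, abs_sub_comm (F x), abs_of_nonneg (sub_nonneg.2 h)]
    exact (hF.sub_le_image_sub h).trans (le_abs_self _)
  · rw [abs_of_nonneg (sub_nonneg.2 h)]
    exact (hF.sub_le_image_sub h).trans (le_abs_self _)

theorem surjective (hF : IsLiftDeg m F) : Function.Surjective F := by
  refine hF.continuous.surjective ?_ ?_
  · refine Filter.tendsto_atTop_mono' _ ?_
      (Filter.tendsto_atTop_add_const_right _ (F 0) Filter.tendsto_id)
    filter_upwards [Filter.eventually_ge_atTop 0] with x hx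
    simp only [id]
    linarith [hF.sub_le_image_sub hx]
  · refine Filter.tendsto_atBot_mono' _ ?_
      (Filter.tendsto_atBot_add_const_right _ (F 0) Filter.tendsto_id)
    filter_upwards [Filter.eventually_le_atBot 0] with x hx
    simp only [id]
    linarith [hF.sub_le_image_sub hx]

theorem uniformContinuous (hF : IsLiftDeg m F) : UniformContinuous F := by
  have hper : Function.Periodic (fun x => F x - m * x) 1 := fun x => by
    simp only [hF.2.2.1]
    ring
  have h := hper.uniformContinuous_of_continuous
    (hF.continuous.sub (continuous_const.mul continuous_id))
  simpa using h.add (Real.uniformContinuous_const_mul (x := (m : ℝ)))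

theorem continuous_log_deriv (hF : IsLiftDeg m F) : Continuous fun x => Real.log (deriv F x) :=
  hF.continuous_deriv.log fun x => (zero_lt_one.trans (hF.2.2.2 x)).ne'

theorem periodic_log_deriv (hF : IsLiftDeg m F) :
    Function.Periodic (fun x => Real.log (deriv F x)) 1 := fun x => by
  simp only [hF.periodic_deriv x]

theorem uniformContinuous_log_deriv (hF : IsLiftDeg m F) :
    UniformContinuous fun x => Real.log (deriv F x) :=
  hF.periodic_log_deriv.uniformContinuous_of_continuous hF.continuous_log_deriv

theorem _root_.distSet_nonempty (k : ℕ) (F : ℝ → ℝ) : (DistSet k F).Nonempty :=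
  ⟨_, 0, 0, by simp, rfl⟩

theorem bddAbove_distSet (hF : IsLiftDeg m F) {k : ℕ} (hk : 1 ≤ k) : BddAbove (DistSet k F) := by
  have hH := hF.iterate hk
  obtain ⟨C, hC⟩ := (hH.periodic_log_deriv.compact_of_continuous one_ne_zero
    hH.continuous_log_deriv).bddAbove
  refine ⟨C, ?_⟩
  rintro _ ⟨x, y, -, rfl⟩
  linarith [hC ⟨x, rfl⟩, Real.log_nonneg (hH.2.2.2 y).le]

end IsLiftDeg

theorem Real.abs_log_sub_log_le {a b : ℝ} (ha : 1 ≤ a) (hb : 1 ≤ b) :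
    |Real.log a - Real.log b| ≤ |a - b| := by
  have key : ∀ {a b : ℝ}, 1 ≤ a → a ≤ b → Real.log b - Real.log a ≤ b - a := by
    intro a b ha hab
    have ha0 : 0 < a := by linarith
    have hb0 : 0 < b := by linarith
    rw [← Real.log_div hb0.ne' ha0.ne']
    refine (Real.log_le_sub_one_of_pos (div_pos hb0 ha0)).trans ?_
    rw [div_sub_one ha0.ne']
    exact div_le_self (by linarith) ha
  rcases le_total a b with h | h
  · rw [abs_sub_comm, abs_sub_comm a b, abs_of_nonneg (sub_nonneg.2 h),
      abs_of_nonneg (sub_nonneg.2 (Real.log_le_log (by linarith) h))]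
    exact key ha h
  · rw [abs_of_nonneg (sub_nonneg.2 h),
      abs_of_nonneg (sub_nonneg.2 (Real.log_le_log (by linarith) h))]
    exact key hb h

theorem abs_sSup_sub_sSup_le {A B : Set ℝ} {η : ℝ} (hA : A.Nonempty) (hB : B.Nonempty)
    (hA' : BddAbove A) (hB' : BddAbove B) (hAB : ∀ a ∈ A, ∃ b ∈ B, |a - b| ≤ η)
    (hBA : ∀ b ∈ B, ∃ a ∈ A, |a - b| ≤ η) : |sSup A - sSup B| ≤ η := by
  rw [abs_sub_le_iff, sub_le_iff_le_add, sub_le_iff_le_add]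
  constructor
  · refine csSup_le hA fun a ha => ?_
    obtain ⟨b, hb, h⟩ := hAB a ha
    linarith [le_csSup hB' hb, (abs_le.1 h).2]
  · refine csSup_le hB fun b hb => ?_
    obtain ⟨a, ha, h⟩ := hBA b hb
    linarith [le_csSup hA' ha, (abs_le.1 h).1]

theorem le_sSup_image_Icc_of_periodic {f : ℝ → ℝ} (hf : Continuous f)
    (hp : Function.Periodic f 1) (x : ℝ) : f x ≤ sSup (f '' Icc 0 1) := by
  obtain ⟨y, hy, hxy⟩ := hp.exists_mem_Ico₀ one_pos x
  rw [hxy]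
  exact le_csSup (isCompact_Icc.image hf).bddAbove ⟨y, Ico_subset_Icc_self hy, rfl⟩

namespace IsLiftDeg

variable {m m' : ℤ} {F G : ℝ → ℝ}

theorem _root_.sSup_abs_sub_le_dC1 (F G : ℝ → ℝ) :
    sSup ((fun x => |F x - G x|) '' Icc 0 1) ≤ dC1 F G :=
  le_add_of_nonneg_right (Real.sSup_nonneg (by rintro _ ⟨x, -, rfl⟩; positivity))

theorem _root_.sSup_abs_deriv_sub_le_dC1 (F G : ℝ → ℝ) :
    sSup ((fun x => |deriv F x - deriv G x|) '' Icc 0 1) ≤ dC1 F G :=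
  le_add_of_nonneg_left (Real.sSup_nonneg (by rintro _ ⟨x, -, rfl⟩; positivity))

theorem degree_eq_of_dC1_lt (hF : IsLiftDeg m F) (hG : IsLiftDeg m' G) (h : dC1 F G < 1 / 2) :
    m = m' := by
  have hle : ∀ x ∈ Icc (0 : ℝ) 1, |F x - G x| < 1 / 2 := fun x hx =>
    ((le_csSup (isCompact_Icc.image (hF.continuous.sub hG.continuous).abs).bddAbove
      ⟨x, hx, rfl⟩).trans (sSup_abs_sub_le_dC1 F G)).trans_lt h
  have h0 := abs_lt.1 (hle 0 (by simp))
  have h1 := abs_lt.1 (hle 1 (by simp))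
  have hF1 := hF.2.2.1 0
  have hG1 := hG.2.2.1 0
  rw [zero_add] at hF1 hG1
  have hlt : |((m - m' : ℤ) : ℝ)| < 1 := by
    push_cast
    rw [abs_lt]
    constructor <;> linarith [h0.1, h0.2, h1.1, h1.2]
  have : |m - m'| < 1 := by exact_mod_cast hlt
  rwa [Int.abs_lt_one_iff, sub_eq_zero] at this

theorem abs_sub_le_dC1 (hF : IsLiftDeg m F) (hG : IsLiftDeg m G) (x : ℝ) :
    |F x - G x| ≤ dC1 F G :=
  (le_sSup_image_Icc_of_periodic (f := fun x => |F x - G x|)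
    (hF.continuous.sub hG.continuous).abs
    (fun x => by simp only [hF.2.2.1, hG.2.2.1, add_sub_add_right_eq_sub]) x).trans
    (sSup_abs_sub_le_dC1 F G)

theorem abs_log_deriv_sub_le_dC1 (hF : IsLiftDeg m F) (hG : IsLiftDeg m' G) (x : ℝ) :
    |Real.log (deriv F x) - Real.log (deriv G x)| ≤ dC1 F G :=
  (Real.abs_log_sub_log_le (hF.2.2.2 x).le (hG.2.2.2 x).le).trans <|
    (le_sSup_image_Icc_of_periodic (f := fun x => |deriv F x - deriv G x|)
      (hF.continuous_deriv.sub hG.continuous_deriv).abs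
      (fun x => by simp only [hF.periodic_deriv x, hG.periodic_deriv x]) x).trans
      (sSup_abs_deriv_sub_le_dC1 F G)

theorem log_deriv_iterate_succ (hF : IsLiftDeg m F) {k : ℕ} (hk : 1 ≤ k) (x : ℝ) :
    Real.log (deriv F^[k + 1] x) =
      Real.log (deriv F (F^[k] x)) + Real.log (deriv F^[k] x) := by
  have hH := hF.iterate hk
  rw [Function.iterate_succ', deriv_comp x (hF.differentiable _) (hH.differentiable x),
    Real.log_mul (zero_lt_one.trans (hF.2.2.2 _)).ne' (zero_lt_one.trans (hH.2.2.2 x)).ne']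

/-- Iteration is continuous at a lift, in the uniform distance of maps and of their
logarithmic derivatives. -/
theorem exists_dC1_lt_iterate_close (hF : IsLiftDeg m F) {k : ℕ} (hk : 1 ≤ k) :
    ∀ η > (0 : ℝ), ∃ δ > (0 : ℝ), ∀ (m' : ℤ) (G : ℝ → ℝ), IsLiftDeg m' G → dC1 F G < δ →
      ∀ x, |F^[k] x - G^[k] x| < η ∧
        |Real.log (deriv F^[k] x) - Real.log (deriv G^[k] x)| < η := by
  induction k, hk using Nat.le_induction with
  | base =>
    intro η hη
    refine ⟨min η (1 / 2), by positivity, fun m' G hG h x => ?_⟩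
    obtain rfl := hF.degree_eq_of_dC1_lt hG (h.trans_le (min_le_right _ _))
    have hη' := h.trans_le (min_le_left _ _)
    simp only [Function.iterate_one]
    exact ⟨(hF.abs_sub_le_dC1 hG x).trans_lt hη',
      (hF.abs_log_deriv_sub_le_dC1 hG x).trans_lt hη'⟩
  | succ k hk ih =>
    intro η hη
    obtain ⟨ρ₁, hρ₁, h₁⟩ := Metric.uniformContinuous_iff.1 hF.uniformContinuous (η / 3)
      (by positivity)
    obtain ⟨ρ₂, hρ₂, h₂⟩ := Metric.uniformContinuous_iff.1 hF.uniformContinuous_log_deriv (η / 3)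
      (by positivity)
    simp only [Real.dist_eq] at h₁ h₂
    obtain ⟨δ, hδ, h⟩ := ih (min (η / 3) (min ρ₁ ρ₂)) (by positivity)
    refine ⟨min δ (min (η / 3) (1 / 2)), by positivity, fun m' G hG hFG x => ?_⟩
    simp only [lt_min_iff] at hFG h
    obtain ⟨hFGδ, hFGη, hFG2⟩ := hFG
    obtain rfl := hF.degree_eq_of_dC1_lt hG hFG2
    obtain ⟨⟨-, hx₁, hx₂⟩, hlog, -⟩ := h m G hG hFGδ x
    have a₁ := abs_lt.1 (h₁ hx₁)
    have a₂ := abs_lt.1 (h₂ hx₂)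
    have a₃ := abs_lt.1 ((hF.abs_sub_le_dC1 hG (G^[k] x)).trans_lt hFGη)
    have a₄ := abs_lt.1 ((hF.abs_log_deriv_sub_le_dC1 hG (G^[k] x)).trans_lt hFGη)
    have a₅ := abs_lt.1 hlog
    rw [hF.log_deriv_iterate_succ hk, hG.log_deriv_iterate_succ hk,
      Function.iterate_succ_apply', Function.iterate_succ_apply', abs_lt, abs_lt]
    refine ⟨⟨?_, ?_⟩, ?_, ?_⟩ <;> linarith [a₁.1, a₁.2, a₂.1, a₂.2, a₃.1, a₃.2, a₄.1, a₄.2,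
      a₅.1, a₅.2]

/-- For `G` close to `F`, the logarithmic derivatives of `F^[k]` and `G^[k]` are close at points
with the same image. -/
theorem exists_dC1_lt_log_deriv_close (hF : IsLiftDeg m F) {k : ℕ} (hk : 1 ≤ k) {η : ℝ}
    (hη : 0 < η) : ∃ δ > (0 : ℝ), ∀ (m' : ℤ) (G : ℝ → ℝ), IsLiftDeg m' G → dC1 F G < δ →
      ∀ x x', F^[k] x = G^[k] x' →
        |Real.log (deriv F^[k] x) - Real.log (deriv G^[k] x')| < η := by
  have hH := hF.iterate hk
  obtain ⟨ρ, hρ, hu⟩ := Metric.uniformContinuous_iff.1 hH.uniformContinuous_log_deriv (η / 2)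
    (by positivity)
  simp only [Real.dist_eq] at hu
  obtain ⟨δ, hδ, h⟩ := hF.exists_dC1_lt_iterate_close hk (min (η / 2) ρ) (by positivity)
  refine ⟨δ, hδ, fun m' G hG hFG x x' hxx' => ?_⟩
  obtain ⟨h₁, h₂⟩ := h m' G hG hFG x'
  have hclose : |x - x'| < ρ := by
    refine (hH.abs_sub_le x x').trans_lt ?_
    rw [hxx', abs_sub_comm]
    exact h₁.trans_le (min_le_right _ _)
  have a := abs_lt.1 (hu hclose)
  have b := abs_lt.1 (h₂.trans_le (min_le_left _ _))
  rw [abs_lt]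
  constructor <;> linarith [a.1, a.2, b.1, b.2]

end IsLiftDeg

/-- continuity of the level-`k` distortion: for every `k ≥ 1`,
on the set of all lifts of C¹ expanding circle maps (of any degree `m ≥ 2`)
the level-`k` distortion `d_k(F) = sSup (DistSet k F)` is real-valued (the
defining set is nonempty and bounded above) and continuous in the C¹ topology
(ε-δ continuity with respect to the C¹ distance). -/
theorem distortion_at_level_k_continuous (k : ℕ) (hk : 1 ≤ k) :
    (∀ (m : ℤ) (F : ℝ → ℝ), IsLiftDeg m F →
      (DistSet k F).Nonempty ∧ BddAbove (DistSet k F)) ∧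
    ∀ (m : ℤ) (F : ℝ → ℝ), IsLiftDeg m F → ∀ ε > (0 : ℝ), ∃ δ > (0 : ℝ),
      ∀ (m' : ℤ) (G : ℝ → ℝ), IsLiftDeg m' G → dC1 F G < δ →
        |sSup (DistSet k F) - sSup (DistSet k G)| < ε := by
  refine ⟨fun m F hF => ⟨distSet_nonempty k F, hF.bddAbove_distSet hk⟩,
    fun m F hF ε hε => ?_⟩
  obtain ⟨δ, hδ, h⟩ := hF.exists_dC1_lt_log_deriv_close hk (η := ε / 4) (by positivity)
  refine ⟨δ, hδ, fun m' G hG hFG => ?_⟩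
  refine (abs_sSup_sub_sSup_le (η := ε / 2) (distSet_nonempty k F)
    (distSet_nonempty k G) (hF.bddAbove_distSet hk) (hG.bddAbove_distSet hk)
    ?_ ?_).trans_lt (by linarith)
  · rintro _ ⟨x, y, hxy, rfl⟩
    obtain ⟨x', hx⟩ := (hG.iterate hk).surjective (F^[k] x)
    obtain ⟨y', hy⟩ := (hG.iterate hk).surjective (F^[k] y)
    refine ⟨_, ⟨x', y', by rwa [hx, hy], rfl⟩, ?_⟩
    have a := abs_lt.1 (h m' G hG hFG x x' hx.symm)
    have b := abs_lt.1 (h m' G hG hFG y y' hy.symm)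
    rw [abs_le]
    constructor <;> linarith [a.1, a.2, b.1, b.2]
  · rintro _ ⟨x', y', hxy, rfl⟩
    obtain ⟨x, hx⟩ := (hF.iterate hk).surjective (G^[k] x')
    obtain ⟨y, hy⟩ := (hF.iterate hk).surjective (G^[k] y')
    refine ⟨_, ⟨x, y, by rwa [hx, hy], rfl⟩, ?_⟩
    have a := abs_lt.1 (h m' G hG hFG x x' hx)
    have b := abs_lt.1 (h m' G hG hFG y y' hy)
    rw [abs_le]
    constructor <;> linarith [a.1, a.2, b.1, b.2]
end
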